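/- arXiv:1303.4109 — 4 statements merged into one kernel-verified Lean document; each statement's English description precedes it below -/
import Mathlib

section
/- Let (Γ,d) be a non-elementary uniformly quasi-geodesic hyperbolic group, and for r>0 let β_r be the uniform probability measure on the ball B(e,r) = {g ∈ Γ : d(e,g) ≤ r}. Then the family {β_r}_{r>0} satisfies the L log L maximal inequality: there is a constant C>0, depending only on (Γ,d), such that for every probability-measure-preserving action of Γ on a standard probability space (X,m) and every measurable f with ∫_X |f| log⁺|f| dm < ∞, one has ∫_X sup_{r>0} π_X(β_r)(|f|) dm ≤ C (1 + ∫_X |f| log⁺|f| dm). -/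
open MeasureTheory Filter Set

/-- A proper left-invariant Gromov-hyperbolic pseudometric on a group, with hyperbolicity given by
the four-point condition, in which points can be interpolated up to an error `c`. -/
structure IsHyperbolicMetric {Γ : Type*} [Group Γ] (d : Γ → Γ → ℝ) (δ c : ℝ) : Prop where
  self : ∀ x, d x x = 0
  symm : ∀ x y, d x y = d y x
  tri : ∀ x y z, d x z ≤ d x y + d y z
  inv : ∀ g x y, d (g * x) (g * y) = d x y
  proper : ∀ R : ℝ, {g : Γ | d 1 g ≤ R}.Finite
  hyp : ∀ x y z w, d x y + d z w ≤ d x z + d y w + 2 * δ ∨ d x y + d z w ≤ d y z + d x w + 2 * δ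
  interp : ∀ g t, 0 ≤ t → t ≤ d 1 g → ∃ m, |d 1 m - t| ≤ c ∧ |d m g - (d 1 g - t)| ≤ c
  delta_nonneg : 0 ≤ δ
  c_nonneg : 0 ≤ c

namespace IsHyperbolicMetric

variable {Γ : Type*} [Group Γ] {d : Γ → Γ → ℝ} {δ c : ℝ}

theorem nonneg (h : IsHyperbolicMetric d δ c) (x y : Γ) : 0 ≤ d x y := by
  have h1 := h.tri x y x
  rw [h.self, h.symm y x] at h1
  linarith

theorem eq_length (h : IsHyperbolicMetric d δ c) (x y : Γ) : d x y = d 1 (x⁻¹ * y) := by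
  rw [← h.inv x⁻¹ x y, inv_mul_cancel]

theorem mul_left_eq (h : IsHyperbolicMetric d δ c) (g x y : Γ) : d (g * x) y = d x (g⁻¹ * y) := by
  rw [← h.inv g⁻¹ (g * x) y, inv_mul_cancel_left]

theorem length_inv (h : IsHyperbolicMetric d δ c) (x : Γ) : d 1 x⁻¹ = d 1 x := by
  rw [← h.inv x 1 x⁻¹, mul_inv_cancel, mul_one, h.symm]

theorem length_mul_le (h : IsHyperbolicMetric d δ c) (x y : Γ) : d 1 (x * y) ≤ d 1 x + d 1 y := by
  have h1 := h.tri 1 x (x * y)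
  rwa [h.eq_length x (x * y), inv_mul_cancel_left] at h1

theorem length_mul_eq (h : IsHyperbolicMetric d δ c) (x y : Γ) : d 1 (x * y) = d x⁻¹ y := by
  rw [h.eq_length x⁻¹ y, inv_inv]

/-- Twice the Gromov product based at the identity. -/
def gromov (d : Γ → Γ → ℝ) (x y : Γ) : ℝ := d 1 x + d 1 y - d x y

theorem gromov_comm (h : IsHyperbolicMetric d δ c) (x y : Γ) : gromov d x y = gromov d y x := by
  unfold gromov
  rw [h.symm x y]
  ring

theorem gromov_trans (h : IsHyperbolicMetric d δ c) (x y z : Γ) :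
    gromov d x z - 2 * δ ≤ gromov d x y ∨ gromov d z y - 2 * δ ≤ gromov d x y := by
  unfold gromov
  have h1 := h.symm y z
  have h2 := h.symm 1 x
  have h3 := h.symm 1 y
  have h4 := h.symm 1 z
  rcases h.hyp x y z 1 with h5 | h5
  · left; linarith
  · right; linarith

theorem gromov_le_left (h : IsHyperbolicMetric d δ c) (x y : Γ) : gromov d x y ≤ 2 * d 1 x := by
  unfold gromov
  have := h.tri 1 x y
  linarith

theorem gromov_mul_left (h : IsHyperbolicMetric d δ c) (g x y : Γ) :
    gromov d x y - 2 * d 1 g ≤ gromov d (g * x) (g * y) := by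
  unfold gromov
  rw [h.inv]
  have h1 := h.tri g 1 (g * x)
  have h2 := h.tri g 1 (g * y)
  rw [h.symm g 1, h.eq_length g, inv_mul_cancel_left] at h1 h2
  linarith

/-- Horofunctions based at two points whose Gromov product is large agree near the identity. -/
theorem abs_sub_le_of_gromov (h : IsHyperbolicMetric d δ c) {k v v' : Γ}
    (hk : 2 * d 1 k + 2 * δ < gromov d v v') :
    |(d k v' - d 1 v') - (d k v - d 1 v)| ≤ 2 * δ := by
  unfold gromov at hk
  have t1 := h.tri 1 k v
  have t2 := h.tri 1 k v'
  have s1 := h.symm v v'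
  have s2 := h.symm v' 1
  have s3 := h.symm v 1
  have s4 := h.symm k 1
  rw [abs_le]
  constructor
  · rcases h.hyp k v v' 1 with h5 | h5 <;> linarith
  · rcases h.hyp k v' v 1 with h5 | h5 <;> linarith

theorem finiteIndex_of_cover {H : Subgroup Γ} {F : Set Γ} (hF : F.Finite)
    (hcov : ∀ g, ∃ f ∈ F, f⁻¹ * g ∈ H) : H.FiniteIndex := by
  have : Finite (Γ ⧸ H) := by
    rw [← Set.finite_univ_iff]
    refine (hF.image (fun g : Γ => (g : Γ ⧸ H))).subset ?_
    intro q _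
    obtain ⟨g, rfl⟩ := QuotientGroup.mk_surjective q
    obtain ⟨f, hf, hfg⟩ := hcov g
    exact ⟨f, hf, QuotientGroup.eq.2 hfg⟩
  exact Subgroup.finiteIndex_of_finite_quotient

/-- A group with an unbounded quasi-morphism having finite sublevel sets is virtually cyclic. -/
theorem exists_cover_zpowers_of_quasimorphism {H : Subgroup Γ} {b : Γ → ℝ} {E : ℝ} (hE : 0 ≤ E)
    (hb1 : b 1 = 0) (hb : ∀ g ∈ H, ∀ k ∈ H, |b (g * k) - b g - b k| ≤ E)
    (hfin : ∀ L : ℝ, {g | g ∈ H ∧ |b g| ≤ L}.Finite) (hinf : (H : Set Γ).Infinite) :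
    ∃ h : Γ, ∃ S : Set Γ, S.Finite ∧ ∀ g ∈ H, ∃ s ∈ S, s⁻¹ * g ∈ Subgroup.zpowers h := by
  obtain ⟨h, hH, hbig⟩ : ∃ h ∈ H, E + 1 ≤ b h := by
    obtain ⟨g, hg⟩ := (hinf.sdiff (hfin (2 * E + 1))).nonempty
    have hgH : g ∈ H := hg.1
    have hgb : 2 * E + 1 < |b g| := by
      by_contra hcon
      exact hg.2 ⟨hgH, not_lt.1 hcon⟩
    rcases lt_abs.1 hgb with h1 | h1
    · exact ⟨g, hgH, by linarith⟩
    · refine ⟨g⁻¹, H.inv_mem hgH, ?_⟩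
      have h2 := abs_le.1 (hb g hgH g⁻¹ (H.inv_mem hgH))
      rw [mul_inv_cancel, hb1] at h2
      linarith [h2.1, h2.2]
  refine ⟨h, {g | g ∈ H ∧ |b g| ≤ b h + E}, hfin _, ?_⟩
  have key : ∀ n : ℕ, ∀ g ∈ H, |b g| ≤ n →
      ∃ s ∈ {g | g ∈ H ∧ |b g| ≤ b h + E}, s⁻¹ * g ∈ Subgroup.zpowers h := by
    intro n
    induction n with
    | zero =>
      intro g hg hgn
      refine ⟨g, ⟨hg, hgn.trans ?_⟩, by simp⟩
      push_cast
      linarith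
    | succ n ih =>
      intro g hg hgn
      push_cast at hgn
      by_cases hsmall : |b g| ≤ b h + E
      · exact ⟨g, ⟨hg, hsmall⟩, by simp⟩
      · have step : ∃ k ∈ Subgroup.zpowers h, k ∈ H ∧ |b (g * k)| ≤ n := by
          rcases lt_abs.1 (not_le.1 hsmall) with h1 | h1
          · refine ⟨h⁻¹, Subgroup.inv_mem _ (Subgroup.mem_zpowers h), H.inv_mem hH, ?_⟩
            have h2 := abs_le.1 (hb (g * h⁻¹) (H.mul_mem hg (H.inv_mem hH)) h hH)
            rw [inv_mul_cancel_right] at h2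
            have h3 := abs_le.1 hgn
            rw [abs_le]
            constructor <;> linarith [h2.1, h2.2, h3.1, h3.2]
          · refine ⟨h, Subgroup.mem_zpowers h, hH, ?_⟩
            have h2 := abs_le.1 (hb g hg h hH)
            have h3 := abs_le.1 hgn
            rw [abs_le]
            constructor <;> linarith [h2.1, h2.2, h3.1, h3.2]
        obtain ⟨k, hk, hkH, hkn⟩ := step
        obtain ⟨s, hs, hsg⟩ := ih (g * k) (H.mul_mem hg hkH) hkn
        refine ⟨s, hs, ?_⟩
        have h4 := Subgroup.mul_mem _ hsg (Subgroup.inv_mem _ hk)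
        rwa [← mul_assoc, mul_inv_cancel_right] at h4
  intro g hg
  obtain ⟨n, hn⟩ := exists_nat_ge |b g|
  exact key n g hg hn

/-- An element `g` coarsely fixing the direction of a far point `v` and with almost no horospherical
displacement moves points on the way to `v` by a bounded amount. -/
theorem displacement_le (h : IsHyperbolicMetric d δ c) {g v y : Γ} {T L : ℝ}
    (hg : d 1 g ≤ T) (hL : |d g v - d 1 v| ≤ L)
    (hv : 2 * (T + c) + 2 * δ < gromov d v (g⁻¹ * v))
    (hy : |d 1 y - T| ≤ c) (hyv : |d y v - (d 1 v - T)| ≤ c) :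
    d y (g * y) ≤ 10 * L + 10 * c + 20 * δ := by
  have hc := h.c_nonneg
  have hδ := h.delta_nonneg
  have hL0 : 0 ≤ L := (abs_nonneg _).trans hL
  have hg0 := h.nonneg 1 g
  rw [abs_le] at hL hy hyv
  have h1 := abs_le.1 (h.abs_sub_le_of_gromov (k := y) (v := v) (v' := g⁻¹ * v) (by linarith))
  rw [← h.mul_left_eq, ← h.mul_left_eq, mul_one] at h1
  have s1 : d g (g * y) = d 1 y := by rw [h.eq_length g, inv_mul_cancel_left]
  have s2 := h.symm (g * y) g
  have s3 := h.symm (g * y) 1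
  have s4 := h.symm y 1
  have h2 : d 1 (g * y) ≤ T + (4 * L + 4 * c + 6 * δ) := by
    rcases h.hyp 1 (g * y) g v with h5 | h5 <;> linarith
  rcases h.hyp y (g * y) 1 v with h5 | h5 <;> linarith

theorem exists_ultrafilter_lim {ω : Ultrafilter ℕ} {u : ℕ → ℝ} {R : ℝ} (hu : ∀ n, |u n| ≤ R) :
    ∃ l, Tendsto u ω (nhds l) := by
  have hm : Icc (-R) R ∈ ω.map u := by
    rw [Ultrafilter.mem_map]
    exact univ_mem' fun n => abs_le.1 (hu n)
  obtain ⟨l, -, hl⟩ := isCompact_Icc.ultrafilter_le_nhds' _ hm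
  exact ⟨l, hl⟩

/-- The subgroup coarsely fixing the limit of the sequence `v` along an ultrafilter. -/
def fixer (h : IsHyperbolicMetric d δ c) (ω : Ultrafilter ℕ) (v : ℕ → Γ)
    (hv : ∀ M : ℝ, ∀ᶠ n in (ω : Filter ℕ), M ≤ d 1 (v n)) : Subgroup Γ where
  carrier := {g | ∀ M : ℝ, ∀ᶠ n in (ω : Filter ℕ), M ≤ gromov d (v n) (g * v n)}
  one_mem' := by
    intro M
    filter_upwards [hv (M / 2)] with n hn
    rw [one_mul, gromov, h.self]
    linarith
  mul_mem' := by
    intro g k hg hk M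
    filter_upwards [hg (M + 2 * δ), hk (M + 2 * δ + 2 * d 1 g)] with n h1 h2
    have h3 := h.gromov_mul_left g (v n) (k * v n)
    rw [← mul_assoc] at h3
    rcases h.gromov_trans (v n) (g * k * v n) (g * v n) with h4 | h4 <;> linarith
  inv_mem' := by
    intro g hg M
    filter_upwards [hg (M + 2 * d 1 g)] with n h1
    have h3 := h.gromov_mul_left g⁻¹ (v n) (g * v n)
    rw [inv_mul_cancel_left, h.length_inv, h.gromov_comm (g⁻¹ * v n)] at h3
    linarith

theorem mem_fixer (h : IsHyperbolicMetric d δ c) {ω : Ultrafilter ℕ} {v : ℕ → Γ}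
    {hv : ∀ M : ℝ, ∀ᶠ n in (ω : Filter ℕ), M ≤ d 1 (v n)} {g : Γ} :
    g ∈ h.fixer ω v hv ↔ ∀ M : ℝ, ∀ᶠ n in (ω : Filter ℕ), M ≤ gromov d (v n) (g * v n) :=
  Iff.rfl

/-- The stabilizer of a boundary point is covered by finitely many cosets of a cyclic group. -/
theorem exists_cover_fixer (h : IsHyperbolicMetric d δ c) {ω : Ultrafilter ℕ} {v : ℕ → Γ}
    (hv : ∀ M : ℝ, ∀ᶠ n in (ω : Filter ℕ), M ≤ d 1 (v n))
    (hinf : (h.fixer ω v hv : Set Γ).Infinite) :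
    ∃ k : Γ, ∃ S : Set Γ, S.Finite ∧
      ∀ g ∈ h.fixer ω v hv, ∃ s ∈ S, s⁻¹ * g ∈ Subgroup.zpowers k := by
  have hlim : ∀ g, ∃ l, Tendsto (fun n => d g (v n) - d 1 (v n)) ω (nhds l) := by
    intro g
    refine exists_ultrafilter_lim (R := d 1 g) fun n => ?_
    have h1 := h.tri 1 g (v n)
    have h2 := h.tri g 1 (v n)
    have h3 := h.symm 1 g
    rw [abs_le]
    constructor <;> linarith
  choose b hb using hlim
  refine exists_cover_zpowers_of_quasimorphism (b := b) (E := 2 * δ)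
    (by linarith [h.delta_nonneg]) ?_ ?_ ?_ hinf
  · refine tendsto_nhds_unique (hb 1) ?_
    simp
  · intro g hg k hk
    refine le_of_tendsto (((hb (g * k)).sub (hb g)).sub (hb k)).abs ?_
    have hg' := h.mem_fixer.1 ((h.fixer ω v hv).inv_mem hg) (2 * d 1 k + 2 * δ + 1)
    filter_upwards [hg'] with n hn
    have h1 := h.abs_sub_le_of_gromov (k := k) (v := v n) (v' := g⁻¹ * v n) (by linarith)
    rw [← h.mul_left_eq, ← h.mul_left_eq, mul_one] at h1
    rw [abs_le] at h1 ⊢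
    constructor <;> linarith [h1.1, h1.2]
  · intro L
    by_contra hLinf
    obtain ⟨t, htS, htc⟩ := Set.Infinite.exists_subset_card_eq hLinf
      ((h.proper (10 * (L + 1) + 10 * c + 20 * δ)).toFinset.card + 1)
    obtain ⟨T, hT0, hT⟩ : ∃ T : ℝ, 0 ≤ T ∧ ∀ g ∈ t, d 1 g ≤ T :=
      ⟨∑ g ∈ t, d 1 g, Finset.sum_nonneg fun g _ => h.nonneg _ _,
        fun g hg => Finset.single_le_sum (f := fun g => d 1 g) (fun g _ => h.nonneg _ _) hg⟩
    have hev : ∀ᶠ n in (ω : Filter ℕ), ∀ g ∈ t, |d g (v n) - d 1 (v n)| ≤ L + 1 ∧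
        2 * (T + c) + 2 * δ + 1 ≤ gromov d (v n) (g⁻¹ * v n) := by
      rw [Filter.eventually_all_finset]
      intro g hg
      have hgS := htS hg
      refine Filter.Eventually.and ?_
        (h.mem_fixer.1 ((h.fixer ω v hv).inv_mem hgS.1) _)
      have h1 := (hb g).abs.eventually_lt_const (u := L + 1) (by linarith [hgS.2])
      exact h1.mono fun n hn => hn.le
    obtain ⟨n, hn, hnT⟩ := (hev.and (hv T)).exists
    obtain ⟨y, hy1, hy2⟩ := h.interp (v n) T hT0 hnT
    have hcard : t.card ≤ (h.proper (10 * (L + 1) + 10 * c + 20 * δ)).toFinset.card := by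
      refine Finset.card_le_card_of_injOn (fun g => y⁻¹ * (g * y)) ?_ ?_
      · intro g hg
        have h1 := hn g hg
        have h2 := h.displacement_le (hT g hg) h1.1 (by linarith [h1.2]) hy1 hy2
        rw [h.eq_length] at h2
        simpa using h2
      · intro g _ g' _ hgg
        simpa using hgg
    omega

/-- In a non-elementary group any `v` can be pushed away from two given directions. -/
theorem exists_separating (h : IsHyperbolicMetric d δ c) [Infinite Γ]
    (hnon : ¬ ∃ H : Subgroup Γ, H.FiniteIndex ∧ IsCyclic H) :
    ∃ K : ℝ, 0 ≤ K ∧ ∀ a b v : Γ, ∃ w, d 1 w ≤ K ∧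
      gromov d a (w * v) ≤ K ∧ gromov d b (w * v) ≤ K := by
  by_contra hcon
  have hcon' : ∀ n : ℕ, ∃ a b v : Γ, ∀ w, d 1 w ≤ n →
      (n : ℝ) < gromov d a (w * v) ∨ (n : ℝ) < gromov d b (w * v) := by
    intro n
    by_contra hn
    refine hcon ⟨n, n.cast_nonneg, ?_⟩
    intro a b v
    by_contra hw
    refine hn ⟨a, b, v, fun w hwn => ?_⟩
    by_contra hor
    push Not at hor
    exact hw ⟨w, hwn, hor.1, hor.2⟩
  choose a b v hv using hcon'
  let ω : Ultrafilter ℕ := Filter.hyperfilter ℕ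
  have hω : ∀ M : ℝ, ∀ᶠ n : ℕ in (ω : Filter ℕ), M ≤ n := fun M =>
    (Nat.hyperfilter_le_atTop) (tendsto_natCast_atTop_atTop.eventually_ge_atTop M)
  have hvinf : ∀ M : ℝ, ∀ᶠ n in (ω : Filter ℕ), M ≤ d 1 (v n) := by
    intro M
    filter_upwards [hω (2 * M)] with n hn
    rcases hv n 1 (by rw [h.self]; exact n.cast_nonneg) with h1 | h1 <;>
    · rw [one_mul, h.gromov_comm] at h1
      have := h.gromov_le_left (v n) (a n)
      have := h.gromov_le_left (v n) (b n)
      linarith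
  have hcoset : ∀ a : ℕ → Γ, ∃ p, ∀ g, (∀ᶠ n : ℕ in (ω : Filter ℕ),
      (n : ℝ) < gromov d (a n) (g * v n)) → p⁻¹ * g ∈ h.fixer ω v hvinf := by
    intro a
    by_cases hex : ∃ p, ∀ᶠ n : ℕ in (ω : Filter ℕ), (n : ℝ) < gromov d (a n) (p * v n)
    · obtain ⟨p, hp⟩ := hex
      refine ⟨p, fun g hg => ?_⟩
      rw [h.mem_fixer]
      intro M
      filter_upwards [hp, hg, hω (M + 2 * d 1 p + 2 * δ)] with n h1 h2 h3
      have h4 := h.gromov_mul_left p⁻¹ (p * v n) (g * v n)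
      rw [inv_mul_cancel_left, h.length_inv, ← mul_assoc] at h4
      rw [h.gromov_comm (a n) (p * v n)] at h1
      rcases h.gromov_trans (p * v n) (g * v n) (a n) with h5 | h5 <;> linarith
    · exact ⟨1, fun g hg => (hex ⟨g, hg⟩).elim⟩
  obtain ⟨p, hp⟩ := hcoset a
  obtain ⟨q, hq⟩ := hcoset b
  have hcov : ∀ g, p⁻¹ * g ∈ h.fixer ω v hvinf ∨ q⁻¹ * g ∈ h.fixer ω v hvinf := by
    intro g
    have h1 : ∀ᶠ n : ℕ in (ω : Filter ℕ), (n : ℝ) < gromov d (a n) (g * v n) ∨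
        (n : ℝ) < gromov d (b n) (g * v n) := by
      filter_upwards [hω (d 1 g)] with n hn using hv n g hn
    exact (Ultrafilter.eventually_or.1 h1).imp (hp g) (hq g)
  have hinf : (h.fixer ω v hvinf : Set Γ).Infinite := by
    intro hfin
    refine Set.infinite_univ (α := Γ)
      (((hfin.image (p * ·)).union (hfin.image (q * ·))).subset fun g _ => ?_)
    exact (hcov g).imp (fun hg => ⟨_, hg, by simp⟩) (fun hg => ⟨_, hg, by simp⟩)
  obtain ⟨k, S, hS, hSk⟩ := h.exists_cover_fixer hvinf hinf
  refine hnon ⟨Subgroup.zpowers k, finiteIndex_of_cover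
    ((hS.image (p * ·)).union (hS.image (q * ·))) fun g => ?_, inferInstance⟩
  rcases hcov g with hg | hg <;> obtain ⟨s, hs, hsg⟩ := hSk _ hg
  · exact ⟨p * s, Or.inl ⟨s, hs, rfl⟩, by simpa [mul_assoc] using hsg⟩
  · exact ⟨q * s, Or.inr ⟨s, hs, rfl⟩, by simpa [mul_assoc] using hsg⟩

/-- The ball of radius `R` around the identity. -/
noncomputable def ball (h : IsHyperbolicMetric d δ c) (R : ℝ) : Finset Γ := (h.proper R).toFinset

theorem mem_ball (h : IsHyperbolicMetric d δ c) {R : ℝ} {g : Γ} : g ∈ h.ball R ↔ d 1 g ≤ R := by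
  simp [ball]

theorem one_mem_ball (h : IsHyperbolicMetric d δ c) {R : ℝ} (hR : 0 ≤ R) : 1 ∈ h.ball R := by
  rwa [h.mem_ball, h.self]

theorem ball_card_pos (h : IsHyperbolicMetric d δ c) {R : ℝ} (hR : 0 ≤ R) : 0 < (h.ball R).card :=
  Finset.card_pos.2 ⟨1, h.one_mem_ball hR⟩

theorem ball_mono (h : IsHyperbolicMetric d δ c) {R R' : ℝ} (hR : R ≤ R') :
    h.ball R ⊆ h.ball R' := fun _ hg => h.mem_ball.2 ((h.mem_ball.1 hg).trans hR)

/-- The annulus of radius `t` and half-width `a` around the identity. -/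
noncomputable def annulus (h : IsHyperbolicMetric d δ c) (t a : ℝ) : Finset Γ :=
  ((h.proper (t + a)).subset (t := {g | |d 1 g - t| ≤ a})
    fun g hg => by
      rw [mem_ofPred_eq] at hg ⊢
      linarith [(abs_le.1 hg).2]).toFinset

theorem mem_annulus (h : IsHyperbolicMetric d δ c) {t a : ℝ} {g : Γ} :
    g ∈ h.annulus t a ↔ |d 1 g - t| ≤ a := by
  simp [annulus]

theorem inv_mem_annulus (h : IsHyperbolicMetric d δ c) {t a : ℝ} {g : Γ} :
    g⁻¹ ∈ h.annulus t a ↔ g ∈ h.annulus t a := by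
  rw [h.mem_annulus, h.mem_annulus, h.length_inv]

theorem annulus_mono (h : IsHyperbolicMetric d δ c) {t a a' : ℝ} (ha : a ≤ a') :
    h.annulus t a ⊆ h.annulus t a' :=
  fun _ hg => h.mem_annulus.2 ((h.mem_annulus.1 hg).trans ha)

theorem exists_mem_annulus (h : IsHyperbolicMetric d δ c) [Infinite Γ] {t : ℝ} (ht : 0 ≤ t) :
    ∃ z, z ∈ h.annulus t c := by
  obtain ⟨g, hg⟩ := (h.proper t).exists_notMem
  obtain ⟨m, hm, -⟩ := h.interp g t ht (not_le.1 hg).le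
  exact ⟨m, h.mem_annulus.2 hm⟩

theorem card_le_mul_of_factor {P U V : Finset Γ} (hP : ∀ p ∈ P, ∃ u ∈ U, u⁻¹ * p ∈ V) :
    P.card ≤ U.card * V.card := by
  classical
  have hsub : P ⊆ (U ×ˢ V).image fun x => x.1 * x.2 := by
    intro p hp
    obtain ⟨u, hu, hv⟩ := hP p hp
    exact Finset.mem_image.2 ⟨(u, u⁻¹ * p), Finset.mem_product.2 ⟨hu, hv⟩, by simp⟩
  exact (Finset.card_le_card hsub).trans (Finset.card_image_le.trans (Finset.card_product _ _).le)

/-- Balls grow by a bounded factor when the radius increases by a bounded amount. -/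
theorem card_ball_add_le (h : IsHyperbolicMetric d δ c) {t k : ℝ} (ht : 0 ≤ t) (hk : 0 ≤ k) :
    (h.ball (t + k)).card ≤ (h.ball t).card * (h.ball (k + 2 * c)).card := by
  have hc := h.c_nonneg
  refine card_le_mul_of_factor fun g hg => ?_
  rw [h.mem_ball] at hg
  by_cases h1 : d 1 g ≤ t
  · refine ⟨g, h.mem_ball.2 h1, ?_⟩
    rw [inv_mul_cancel]
    exact h.one_mem_ball (by linarith)
  by_cases h2 : t < c
  · refine ⟨1, h.one_mem_ball ht, h.mem_ball.2 ?_⟩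
    rw [inv_one, one_mul]
    linarith
  obtain ⟨m, hm1, hm2⟩ := h.interp g (t - c) (by linarith) (by linarith)
  rw [abs_le] at hm1 hm2
  refine ⟨m, h.mem_ball.2 (by linarith), h.mem_ball.2 ?_⟩
  rw [← h.eq_length]
  linarith

theorem abs_length_join (h : IsHyperbolicMetric d δ c) {K : ℝ} {z w v : Γ} (hw : d 1 w ≤ K)
    (hz : gromov d z⁻¹ (w * v) ≤ K) : |d 1 (z * (w * v)) - (d 1 z + d 1 v)| ≤ 2 * K := by
  unfold gromov at hz
  rw [← h.length_mul_eq, h.length_inv] at hz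
  have h0 := h.nonneg 1 w
  have h1 := h.length_mul_le z (w * v)
  have h2 := h.length_mul_le w v
  have h3 := h.length_mul_le w⁻¹ (w * v)
  rw [inv_mul_cancel_left, h.length_inv] at h3
  rw [abs_le]
  constructor <;> linarith

/-- Every `v` can be prolonged, by an element of length at most `K`, away from two directions. -/
def Separating (d : Γ → Γ → ℝ) (K : ℝ) : Prop :=
  0 ≤ K ∧ ∀ a b v : Γ, ∃ w, d 1 w ≤ K ∧ gromov d a (w * v) ≤ K ∧ gromov d b (w * v) ≤ K

theorem card_le_of_prolong (h : IsHyperbolicMetric d δ c) {K : ℝ} (hs : Separating d K) (z z' : Γ)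
    {V P : Finset Γ} (hP : ∀ v ∈ V, ∀ w, d 1 w ≤ K → gromov d z⁻¹ (w * v) ≤ K →
      gromov d z'⁻¹ (w * v) ≤ K → z * (w * v) ∈ P) :
    V.card ≤ (h.ball K).card * P.card := by
  classical
  choose w hw1 hw2 hw3 using hs.2 z⁻¹ z'⁻¹
  refine Finset.card_le_mul_card_image_of_maps_to (f := fun v => z * (w v * v))
    (fun v hv => hP v hv _ (hw1 v) (hw2 v) (hw3 v)) _ fun p _ => ?_
  refine Finset.card_le_card_of_injOn w (fun v _ => h.mem_ball.2 (hw1 v)) ?_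
  intro v hv v' hv' hvv
  have h1 := (Finset.mem_filter.1 hv).2.trans (Finset.mem_filter.1 hv').2.symm
  simpa [hvv] using h1

/-- Annuli of different widths have comparable size. -/
theorem card_annulus_le (h : IsHyperbolicMetric d δ c) [Infinite Γ] {K : ℝ} (hs : Separating d K)
    {t a : ℝ} (ht : 0 ≤ t) (ha : 0 ≤ a) :
    (h.annulus t a).card ≤
      (h.ball (2 * a + c)).card * (h.ball K).card * (h.annulus t (2 * c + 2 * K)).card := by
  have hc := h.c_nonneg
  have hK := hs.1
  rcases lt_or_ge t a with hta | hta
  · have h1 : h.annulus t a ⊆ h.ball (2 * a + c) := fun g hg => by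
      have := abs_le.1 (h.mem_annulus.1 hg)
      rw [h.mem_ball]
      linarith
    obtain ⟨z, hz⟩ := h.exists_mem_annulus ht
    have h2 : 0 < (h.annulus t (2 * c + 2 * K)).card :=
      Finset.card_pos.2 ⟨z, h.annulus_mono (by linarith) hz⟩
    rw [mul_assoc]
    exact (Finset.card_le_card h1).trans
      (Nat.le_mul_of_pos_right _ (Nat.mul_pos (h.ball_card_pos hK) h2))
  · have h1 : (h.annulus t a).card ≤ (h.ball (2 * a + c)).card * (h.annulus (t - a) c).card := by
      refine card_le_mul_of_factor fun p hp => ?_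
      have hp' := abs_le.1 (h.mem_annulus.1 hp)
      obtain ⟨m, hm1, hm2⟩ := h.interp p (d 1 p - (t - a)) (by linarith) (by linarith)
      rw [abs_le] at hm1
      refine ⟨m, h.mem_ball.2 (by linarith), h.mem_annulus.2 ?_⟩
      rwa [← h.eq_length, ← sub_sub_cancel (d 1 p) (t - a)]
    obtain ⟨z, hz⟩ := h.exists_mem_annulus ha
    have hz' := abs_le.1 (h.mem_annulus.1 hz)
    have h2 : (h.annulus (t - a) c).card ≤
        (h.ball K).card * (h.annulus t (2 * c + 2 * K)).card := by
      refine h.card_le_of_prolong hs z z fun v hv w hw hzw _ => h.mem_annulus.2 ?_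
      have h3 := abs_le.1 (h.abs_length_join hw hzw)
      have h4 := abs_le.1 (h.mem_annulus.1 hv)
      rw [abs_le]
      constructor <;> linarith
    rw [mul_assoc]
    exact h1.trans (Nat.mul_le_mul_left _ h2)

/-- Coarse supermultiplicativity of growth. -/
theorem card_annulus_mul_le (h : IsHyperbolicMetric d δ c) {K : ℝ} (hs : Separating d K)
    (s t a : ℝ) :
    (h.annulus s a).card * (h.annulus t a).card ≤
      (h.ball (4 * a + K + 2 * δ)).card * (h.ball K).card *
        (h.ball (s + t + (2 * a + 2 * K))).card := by
  classical
  choose w hw1 hw2 _ using fun x : Γ × Γ => hs.2 x.1⁻¹ x.1⁻¹ x.2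
  rw [← Finset.card_product]
  refine Finset.card_le_mul_card_image_of_maps_to (f := fun x => x.1 * (w x * x.2)) ?_ _ ?_
  · intro x hx
    rw [Finset.mem_product] at hx
    have h1 := abs_le.1 (h.mem_annulus.1 hx.1)
    have h2 := abs_le.1 (h.mem_annulus.1 hx.2)
    have h3 := abs_le.1 (h.abs_length_join (hw1 x) (hw2 x))
    rw [h.mem_ball]
    linarith
  · intro p _
    rcases Finset.eq_empty_or_nonempty
      ({x ∈ h.annulus s a ×ˢ h.annulus t a | x.1 * (w x * x.2) = p}) with he | ⟨x₀, hx₀⟩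
    · rw [he, Finset.card_empty]
      exact Nat.zero_le _
    have hfib : ∀ x ∈ ({x ∈ h.annulus s a ×ˢ h.annulus t a | x.1 * (w x * x.2) = p}),
        x.1 * (w x * x.2) = p ∧ |d 1 x.1 - s| ≤ a ∧ 2 * d 1 x.1 - K ≤ gromov d x.1 p := by
      intro x hx
      rw [Finset.mem_filter, Finset.mem_product] at hx
      refine ⟨hx.2, h.mem_annulus.1 hx.1.1, ?_⟩
      have h2 := hw2 x
      unfold gromov at h2 ⊢
      rw [← h.length_mul_eq, hx.2, h.length_inv] at h2
      rw [h.eq_length x.1 p, ← hx.2, inv_mul_cancel_left, hx.2]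
      linarith
    rw [← Finset.card_product]
    refine Finset.card_le_card_of_injOn (fun x => (x₀.1⁻¹ * x.1, w x)) ?_ ?_
    · intro x hx
      obtain ⟨-, h1, h2⟩ := hfib x hx
      obtain ⟨-, h3, h4⟩ := hfib x₀ hx₀
      refine Finset.mem_product.2 ⟨h.mem_ball.2 ?_, h.mem_ball.2 (hw1 x)⟩
      rw [← h.eq_length]
      rw [abs_le] at h1 h3
      rw [h.gromov_comm x.1 p] at h2
      have h5 : 2 * (s - a) - K - 2 * δ ≤ gromov d x₀.1 x.1 := by
        rcases h.gromov_trans x₀.1 x.1 p with h5 | h5 <;> linarith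
      unfold gromov at h5
      linarith
    · intro x hx y hy hxy
      have h1 := (hfib x hx).1.trans (hfib y hy).1.symm
      simp only [Prod.mk.injEq, mul_right_inj] at hxy
      rw [hxy.1, hxy.2, mul_right_inj, mul_right_inj] at h1
      exact Prod.ext hxy.1 h1

/-- Balls of radius `r` centred on a sphere meet it in about as many points as there are in a
sphere of radius `r / 2`. -/
theorem card_annulus_inter_ball_le (h : IsHyperbolicMetric d δ c) {N a r k : ℝ} (hN : 2 * a ≤ N)
    (hr : 0 ≤ r) (hrN : r ≤ N) (hk : 0 ≤ k) {q : Γ} (hq : q ∈ h.annulus N a) (P : Finset Γ)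
    (hP : ∀ q' ∈ P, q' ∈ h.annulus N a ∧ d q q' ≤ r + k) :
    P.card ≤ (h.annulus (r / 2) (4 * a + k + 4 * c + 2 * δ)).card := by
  have hc := h.c_nonneg
  have hδ := h.delta_nonneg
  have hq' := abs_le.1 (h.mem_annulus.1 hq)
  obtain ⟨m, hm1, hm2⟩ := h.interp q (d 1 q - r / 2) (by linarith) (by linarith)
  rw [abs_le] at hm1 hm2
  refine Finset.card_le_card_of_injOn (fun q' => m⁻¹ * q') (fun q' hqP => ?_) (by simp)
  obtain ⟨h1, h2⟩ := hP q' hqP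
  have h1' := abs_le.1 (h.mem_annulus.1 h1)
  refine h.mem_annulus.2 ?_
  rw [← h.eq_length]
  have h3 := h.tri 1 m q'
  have s1 := h.symm q m
  have s2 := h.symm q' m
  have s3 := h.symm m 1
  have s4 := h.symm q 1
  have s5 := h.symm q' 1
  have s6 := h.symm q' q
  rw [abs_le]
  constructor
  · linarith
  · rcases h.hyp m q' q 1 with h5 | h5 <;> linarith

/-- The proportion of a sphere which is mapped to itself by translation by `g`. -/
theorem card_annulus_le_mul_card_translate (h : IsHyperbolicMetric d δ c) [Infinite Γ]
    [DecidableEq Γ] {K : ℝ}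
    (hs : Separating d K) {N : ℝ} {g : Γ} (hN : 2 * (3 * c + 4 * K) ≤ N) (hg : d 1 g ≤ N) :
    (h.annulus N (3 * c + 4 * K)).card ≤
      ((h.ball (2 * (4 * c + 4 * K) + c)).card * (h.ball K).card * (h.ball K).card) *
        (h.annulus (d 1 g / 2) (2 * c + 2 * K)).card *
        ({q ∈ h.annulus N (3 * c + 4 * K) | q * g ∈ h.annulus N (3 * c + 4 * K)}).card := by
  have hc := h.c_nonneg
  have hK := hs.1
  have hg0 := h.nonneg 1 g
  have h1 : (h.annulus N (3 * c + 4 * K)).card ≤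
      (h.annulus (d 1 g / 2) (2 * c + 2 * K)).card *
        (h.annulus (N - d 1 g / 2) (4 * c + 4 * K)).card := by
    refine card_le_mul_of_factor fun p hp => ?_
    have hp' := abs_le.1 (h.mem_annulus.1 hp)
    obtain ⟨m, hm1, hm2⟩ := h.interp p (d 1 g / 2) (by linarith) (by linarith)
    refine ⟨m, h.mem_annulus.2 (hm1.trans (by linarith)), h.mem_annulus.2 ?_⟩
    rw [← h.eq_length]
    rw [abs_le] at hm2 ⊢
    constructor <;> linarith
  have h2 := h.card_annulus_le hs (t := N - d 1 g / 2) (a := 4 * c + 4 * K)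
    (by linarith) (by linarith)
  obtain ⟨m, hm1, hm2⟩ := h.interp g (d 1 g / 2) (by linarith) (by linarith)
  rw [h.symm m g, h.eq_length g m] at hm2
  rw [abs_le] at hm1 hm2
  have h3 : (h.annulus (N - d 1 g / 2) (2 * c + 2 * K)).card ≤ (h.ball K).card *
      (({q ∈ h.annulus N (3 * c + 4 * K) | q * g ∈ h.annulus N (3 * c + 4 * K)}).image
        (fun q => q⁻¹)).card := by
    refine h.card_le_of_prolong hs m (g⁻¹ * m) fun v hv w hw hz hz' => ?_
    have h4 := abs_le.1 (h.abs_length_join hw hz)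
    have h5 := abs_le.1 (h.abs_length_join hw hz')
    have h6 := abs_le.1 (h.mem_annulus.1 hv)
    refine Finset.mem_image.2 ⟨(m * (w * v))⁻¹, Finset.mem_filter.2 ⟨?_, ?_⟩, inv_inv _⟩
    · rw [h.inv_mem_annulus, h.mem_annulus, abs_le]
      constructor <;> linarith
    · rw [← h.inv_mem_annulus, mul_inv_rev, inv_inv, ← mul_assoc, h.mem_annulus, abs_le]
      constructor <;> linarith
  rw [Finset.card_image_of_injective _ inv_injective] at h3
  calc _ ≤ _ := h1
    _ ≤ (h.annulus (d 1 g / 2) (2 * c + 2 * K)).card * (_ * (_ * _)) :=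
        Nat.mul_le_mul_left _ (h2.trans (Nat.mul_le_mul_left _ h3))
    _ = _ := by ring

/-- The spheres of a non-elementary hyperbolic group: the estimates used for the maximal
inequality. -/
theorem exists_sphere_estimates (h : IsHyperbolicMetric d δ c) [Infinite Γ] [DecidableEq Γ]
    (hnon : ¬ ∃ H : Subgroup Γ, H.FiniteIndex ∧ IsCyclic H) :
    ∃ (α : ℝ → ℕ) (S : ℝ → Finset Γ) (C : ℕ) (k N₀ : ℝ), 0 ≤ k ∧ (∀ t, 0 ≤ t → 0 < α t) ∧
      (∀ N, 0 ≤ N → (S N).Nonempty) ∧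
      (∀ N r g, N₀ ≤ N → r ≤ N → d 1 g ≤ r →
        (S N).card * α r ≤ C * (h.ball r).card * ({q ∈ S N | q * g ∈ S N}).card) ∧
      (∀ N, ∀ q ∈ S N, ∀ q' ∈ S N, ∀ q'' ∈ S N, d q q'' ≤ max (d q q') (d q' q'') + k) ∧
      (∀ N r, N₀ ≤ N → 0 ≤ r → r ≤ N → ∀ q ∈ S N, ∀ P ⊆ S N, (∀ q' ∈ P, d q q' ≤ r + 1 + k) →
        P.card ≤ C * α r) := by
  obtain ⟨K, hs⟩ : ∃ K, Separating d K := h.exists_separating hnon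
  have hK := hs.1
  have hc := h.c_nonneg
  have hδ := h.delta_nonneg
  set a := 2 * c + 2 * K with ha
  set b := 3 * c + 4 * K with hb
  set k := 2 * b + 2 * δ with hk
  have hne : ∀ t a', 0 ≤ t → c ≤ a' → (h.annulus t a').Nonempty := fun t a' ht ha' =>
    (h.exists_mem_annulus ht).imp fun z hz => h.annulus_mono ha' hz
  set C₁ := (h.ball (2 * (4 * c + 4 * K) + c)).card * (h.ball K).card * (h.ball K).card
  set C₂ := (h.ball (4 * a + K + 2 * δ)).card * (h.ball K).card *
    (h.ball (2 * a + 2 * K + 2 * c)).card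
  set e := 4 * b + (1 + k) + 4 * c + 2 * δ with he
  set C₃ := (h.ball (2 * e + c)).card * (h.ball K).card
  refine ⟨fun r => (h.annulus (r / 2) a).card, fun N => h.annulus N b, C₁ * C₂ + C₃, k, 2 * b,
    by linarith, fun t ht => Finset.card_pos.2 (hne _ _ (by linarith) (by linarith)),
    fun N hN => hne _ _ hN (by linarith), ?_, ?_, ?_⟩
  · intro N r g hN hr hg
    have hg0 := h.nonneg 1 g
    have h1 := h.card_annulus_le_mul_card_translate hs hN (hg.trans hr)
    have h2 := h.card_annulus_mul_le hs (d 1 g / 2) (r / 2) a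
    have h3 := h.card_ball_add_le (t := d 1 g / 2 + r / 2) (k := 2 * a + 2 * K)
      (by linarith) (by linarith)
    have h4 := Finset.card_le_card (h.ball_mono (R := d 1 g / 2 + r / 2) (R' := r) (by linarith))
    have h5 : (h.annulus (d 1 g / 2) a).card * (h.annulus (r / 2) a).card ≤
        C₂ * (h.ball r).card :=
      calc _ ≤ _ := h2
        _ ≤ (h.ball (4 * a + K + 2 * δ)).card * (h.ball K).card * ((h.ball r).card *
            (h.ball (2 * a + 2 * K + 2 * c)).card) :=
          Nat.mul_le_mul_left _ (h3.trans (Nat.mul_le_mul_right _ h4))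
        _ = _ := by ring
    calc _ ≤ _ := Nat.mul_le_mul_right _ h1
      _ = C₁ * ({q ∈ h.annulus N b | q * g ∈ h.annulus N b}).card *
          ((h.annulus (d 1 g / 2) a).card * (h.annulus (r / 2) a).card) := by ring
      _ ≤ C₁ * ({q ∈ h.annulus N b | q * g ∈ h.annulus N b}).card * (C₂ * (h.ball r).card) :=
        Nat.mul_le_mul_left _ h5
      _ = C₁ * C₂ * (h.ball r).card *
          ({q ∈ h.annulus N b | q * g ∈ h.annulus N b}).card := by ring
      _ ≤ _ := Nat.mul_le_mul_right _ (Nat.mul_le_mul_right _ (Nat.le_add_right _ _))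
  · intro N q hq q' hq' q'' hq''
    have h1 := abs_le.1 (h.mem_annulus.1 hq)
    have h2 := abs_le.1 (h.mem_annulus.1 hq')
    have h3 := abs_le.1 (h.mem_annulus.1 hq'')
    have s1 := h.symm q 1
    have s2 := h.symm q' 1
    have s3 := h.symm q'' 1
    have s4 := h.symm q'' q'
    have m1 := le_max_left (d q q') (d q' q'')
    have m2 := le_max_right (d q q') (d q' q'')
    rcases h.hyp q q'' q' 1 with h5 | h5 <;> linarith
  · intro N r hN hr hrN q hq P hPS hP
    have h1 := h.card_annulus_inter_ball_le (k := 1 + k) hN hr hrN (by linarith) hq P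
      fun q' hq' => ⟨hPS hq', by linarith [hP q' hq']⟩
    have h2 := h.card_annulus_le hs (t := r / 2) (a := e) (by linarith) (by linarith)
    exact (h1.trans h2).trans (Nat.mul_le_mul_right _ (Nat.le_add_left _ _))

end IsHyperbolicMetric

section FiniteMaximal

/-- The sum of `φ` over the ball of radius `r` around `q` in the finite space `S`, divided by a
normalising factor `α r`. -/
noncomputable def ballAvg {ι : Type*} (S : Finset ι) (D : ι → ι → ℝ) (α : ℝ → ℕ) (φ : ι → ℝ)
    (r : ℝ) (q : ι) : ℝ :=
  (α r : ℝ)⁻¹ * ∑ q' ∈ S with D q q' ≤ r, φ q'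

variable {ι : Type*} {S : Finset ι} {D : ι → ι → ℝ} {α : ℝ → ℕ} {C k R : ℝ}

/-- The weak type (1,1) inequality on a finite space which is ultrametric up to an additive
constant. -/
theorem mul_card_le_of_lt_ballAvg (hself : ∀ x, D x x = 0) (hsymm : ∀ x y, D x y = D y x)
    (hα : ∀ r, 0 ≤ r → 0 < α r)
    (hultra : ∀ q ∈ S, ∀ q' ∈ S, ∀ q'' ∈ S, D q q'' ≤ max (D q q') (D q' q'') + k)
    (hC : 0 ≤ C)
    (hcount : ∀ r, 0 ≤ r → r ≤ R → ∀ q ∈ S, ∀ P ⊆ S, (∀ q' ∈ P, D q q' ≤ r + 1 + k) →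
      (P.card : ℝ) ≤ C * α r)
    {φ : ι → ℝ} (hφ : ∀ q, 0 ≤ φ q) {ρ : ι → ℝ} (hρ0 : ∀ q, 0 ≤ ρ q) (hρR : ∀ q, ρ q ≤ R)
    {t : ℝ} (ht : 0 < t) {E : Finset ι} (hES : E ⊆ S) (hE : ∀ q ∈ E, t < ballAvg S D α φ (ρ q) q) :
    t * E.card ≤ C * ∑ q ∈ S, φ q := by
  classical
  let B : ι → Finset ι := fun q => {q' ∈ S | D q q' ≤ ρ q}
  have hB : ∀ q q', q' ∈ B q ↔ q' ∈ S ∧ D q q' ≤ ρ q := fun q q' => Finset.mem_filter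
  obtain ⟨u, huE, hdisj, hcov⟩ := Vitali.exists_disjoint_subfamily_covering_enlargement
    (fun q => (B q : Set ι)) (E : Set ι) (fun q => Real.exp (ρ q)) (Real.exp 1)
    (Real.one_lt_exp_iff.2 one_pos) (fun q _ => (Real.exp_pos _).le) (Real.exp R)
    (fun q _ => Real.exp_le_exp.2 (hρR q))
    (fun q hq => ⟨q, Finset.mem_coe.2 ((hB q q).2 ⟨hES hq, by rw [hself]; exact hρ0 q⟩)⟩)
  lift u to Finset ι using E.finite_toSet.subset huE
  rw [Finset.coe_subset] at huE
  let B' : ι → Finset ι := fun q => {q' ∈ S | D q q' ≤ ρ q + 1 + k}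
  have hEB : E ⊆ u.biUnion B' := by
    intro q hq
    obtain ⟨p, hp, ⟨z, hzq, hzp⟩, hle⟩ := hcov q hq
    have hzq' := (hB q z).1 hzq
    have hzp' := (hB p z).1 hzp
    rw [← Real.exp_add, Real.exp_le_exp] at hle
    refine Finset.mem_biUnion.2 ⟨p, hp, Finset.mem_filter.2 ⟨hES hq, ?_⟩⟩
    refine (hultra p (hES (huE hp)) z hzq'.1 q (hES hq)).trans ?_
    have h1 : max (D p z) (D z q) ≤ ρ p + 1 :=
      max_le (by linarith [hzp'.2]) (by rw [hsymm z q]; linarith [hzq'.2])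
    linarith
  have hterm : ∀ p ∈ u, t * (B' p).card ≤ C * ∑ q ∈ B p, φ q := by
    intro p hp
    have hpos : (0 : ℝ) < α (ρ p) := by exact_mod_cast hα _ (hρ0 p)
    have h1 := hcount (ρ p) (hρ0 p) (hρR p) p (hES (huE hp)) (B' p) (Finset.filter_subset _ _)
      fun q' hq' => (Finset.mem_filter.1 hq').2
    have h2 := hE p (huE hp)
    rw [ballAvg, inv_mul_eq_div, lt_div_iff₀ hpos] at h2
    calc t * (B' p).card ≤ t * (C * α (ρ p)) := by gcongr
      _ = C * (t * α (ρ p)) := by ring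
      _ ≤ C * ∑ q ∈ B p, φ q := by gcongr
  calc t * E.card ≤ t * ∑ p ∈ u, ((B' p).card : ℝ) := by
        gcongr
        exact_mod_cast (Finset.card_le_card hEB).trans Finset.card_biUnion_le
    _ = ∑ p ∈ u, t * (B' p).card := Finset.mul_sum _ _ _
    _ ≤ ∑ p ∈ u, C * ∑ q ∈ B p, φ q := Finset.sum_le_sum hterm
    _ = C * ∑ q ∈ u.biUnion B, φ q := by
        rw [← Finset.mul_sum, Finset.sum_biUnion]
        intro p hp p' hp' hpp
        exact Finset.disjoint_coe.1 (hdisj hp hp' hpp)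
    _ ≤ C * ∑ q ∈ S, φ q := by
        gcongr
        · exact fun q _ _ => hφ q
        · exact Finset.biUnion_subset.2 fun p _ => Finset.filter_subset _ _

theorem le_two_add_sum_dyadic {y : ℝ} {J : ℕ} (hy : y ≤ 2 ^ (J + 1)) :
    y ≤ 2 + ∑ j ∈ Finset.range J, if (2 : ℝ) ^ (j + 1) < y then (2 : ℝ) ^ (j + 1) else 0 := by
  induction J with
  | zero => simpa using hy
  | succ J ih =>
    rw [Finset.sum_range_succ]
    by_cases h1 : y ≤ 2 ^ (J + 1)
    · rw [if_neg h1.not_gt, add_zero]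
      exact ih h1
    · have h2 : ∀ j ∈ Finset.range J, (if (2 : ℝ) ^ (j + 1) < y then (2 : ℝ) ^ (j + 1) else 0)
          = 2 * 2 ^ j := by
        intro j hj
        have h3 : (2 : ℝ) ^ (j + 1) ≤ 2 ^ (J + 1) :=
          pow_le_pow_right₀ one_le_two (by have := Finset.mem_range.1 hj; omega)
        rw [if_pos (h3.trans_lt (not_le.1 h1)), pow_succ]
        ring
      rw [Finset.sum_congr rfl h2, ← Finset.mul_sum, geom_sum_eq (by norm_num),
        if_pos (not_le.1 h1)]
      refine hy.trans (le_of_eq ?_)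
      ring

theorem sum_dyadic_indicator_le (y : ℝ) (J : ℕ) :
    (∑ j ∈ Finset.range J, if (2 : ℝ) ^ (j + 1) < y then (1 : ℝ) else 0) ≤
      2 * max (Real.log y) 0 := by
  induction J with
  | zero => simp
  | succ J ih =>
    by_cases h1 : (2 : ℝ) ^ (J + 1) < y
    · have h2 : (∑ j ∈ Finset.range (J + 1), if (2 : ℝ) ^ (j + 1) < y then (1 : ℝ) else 0) ≤
          (J + 1 : ℝ) := by
        refine (Finset.sum_le_card_nsmul _ _ 1 fun j _ => ?_).trans (by simp)
        split_ifs <;> norm_num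
      have h3 := Real.log_le_log (by positivity) h1.le
      rw [Real.log_pow] at h3
      push_cast at h3
      have h4 := Real.log_two_gt_d9
      have h5 : (J + 1 : ℝ) * (1 / 2) ≤ (J + 1 : ℝ) * Real.log 2 := by gcongr; linarith
      linarith [le_max_left (Real.log y) 0]
    · rw [Finset.sum_range_succ, if_neg h1, add_zero]
      exact ih

theorem mul_log_mul_le {a y : ℝ} (ha : 1 ≤ a) (hy : 0 ≤ y) :
    y * max (Real.log (a * y)) 0 ≤
      3 * Real.log a + (Real.log a + 1) * (y * max (Real.log y) 0) := by
  have hla := Real.log_nonneg ha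
  rcases hy.eq_or_lt with rfl | hy
  · simp [hla]
  have h1 : max (Real.log (a * y)) 0 ≤ Real.log a + max (Real.log y) 0 := by
    rw [Real.log_mul (by positivity) hy.ne']
    exact max_le (by linarith [le_max_left (Real.log y) 0]) (by positivity)
  have h2 : y ≤ 3 + y * max (Real.log y) 0 := by
    rcases le_or_gt y 3 with h3 | h3
    · have : 0 ≤ y * max (Real.log y) 0 := by positivity
      linarith
    · have h4 : 1 ≤ Real.log y := by
        rw [Real.le_log_iff_exp_le hy]
        linarith [Real.exp_one_lt_d9]
      have : y * 1 ≤ y * max (Real.log y) 0 := by gcongr; exact h4.trans (le_max_left _ _)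
      linarith
  calc _ ≤ y * (Real.log a + max (Real.log y) 0) := by gcongr
    _ = Real.log a * y + y * max (Real.log y) 0 := by ring
    _ ≤ Real.log a * (3 + y * max (Real.log y) 0) + y * max (Real.log y) 0 := by gcongr
    _ = _ := by ring

/-- The `L log L` maximal inequality on a finite space which is ultrametric up to an additive
constant, in linearised form. -/
theorem sum_ballAvg_le (hself : ∀ x, D x x = 0) (hsymm : ∀ x y, D x y = D y x)
    (hα : ∀ r, 0 ≤ r → 0 < α r) (hk : 0 ≤ k)
    (hultra : ∀ q ∈ S, ∀ q' ∈ S, ∀ q'' ∈ S, D q q'' ≤ max (D q q') (D q' q'') + k)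
    (hC : 1 ≤ C)
    (hcount : ∀ r, 0 ≤ r → r ≤ R → ∀ q ∈ S, ∀ P ⊆ S, (∀ q' ∈ P, D q q' ≤ r + 1 + k) →
      (P.card : ℝ) ≤ C * α r)
    {φ : ι → ℝ} (hφ : ∀ q, 0 ≤ φ q) {ρ : ι → ℝ} (hρ0 : ∀ q, 0 ≤ ρ q) (hρR : ∀ q, ρ q ≤ R) :
    ∑ q ∈ S, ballAvg S D α φ (ρ q) q ≤ (2 + 12 * C * Real.log (2 * C) + 4 * C) *
      ∑ q ∈ S, (1 + φ q * max (Real.log (φ q)) 0) := by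
  classical
  set M : ι → ℝ := fun q => ballAvg S D α φ (ρ q) q with hM
  have hC0 : 0 < C := by linarith
  have hlog : 0 ≤ Real.log (2 * C) := Real.log_nonneg (by linarith)
  have hweak : ∀ t : ℝ, 0 < t → t * ({q ∈ S | t < M q}).card ≤
      2 * C * ∑ q ∈ S, if t < 2 * C * φ q then φ q else 0 := by
    intro t ht
    set ψ : ι → ℝ := fun q => if t < 2 * C * φ q then φ q else 0 with hψ
    have h1 := mul_card_le_of_lt_ballAvg hself hsymm hα hultra hC0.le hcount (φ := ψ) (t := t / 2)
      (fun q => by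
        simp only [hψ]
        split_ifs
        · exact hφ q
        · exact le_rfl) hρ0 hρR (by positivity)
      (E := {q ∈ S | t < M q}) (Finset.filter_subset _ _) ?_
    · linarith
    · intro q hq
      obtain ⟨hqS, hqt⟩ := Finset.mem_filter.1 hq
      have hpos : (0 : ℝ) < α (ρ q) := by exact_mod_cast hα _ (hρ0 q)
      have h2 := hcount (ρ q) (hρ0 q) (hρR q) q hqS {q' ∈ S | D q q' ≤ ρ q}
        (Finset.filter_subset _ _) fun q' hq' => by linarith [(Finset.mem_filter.1 hq').2]
      have h3 : ∑ q' ∈ S with D q q' ≤ ρ q, φ q' ≤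
          ∑ q' ∈ S with D q q' ≤ ρ q, ψ q' + t / 2 * α (ρ q) := by
        calc _ ≤ ∑ q' ∈ S with D q q' ≤ ρ q, (ψ q' + t / (2 * C)) := by
              refine Finset.sum_le_sum fun q' _ => ?_
              simp only [hψ]
              split_ifs with h4
              · have : 0 < t / (2 * C) := by positivity
                linarith
              · rw [zero_add, le_div_iff₀ (by positivity)]
                linarith
          _ = ∑ q' ∈ S with D q q' ≤ ρ q, ψ q' +
              ({q' ∈ S | D q q' ≤ ρ q}).card * (t / (2 * C)) := by
              rw [Finset.sum_add_distrib, Finset.sum_const, nsmul_eq_mul]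
          _ ≤ ∑ q' ∈ S with D q q' ≤ ρ q, ψ q' + C * α (ρ q) * (t / (2 * C)) := by gcongr
          _ = _ := by field_simp
      simp only [hM, ballAvg] at hqt ⊢
      rw [inv_mul_eq_div, lt_div_iff₀ hpos] at hqt ⊢
      linarith
  obtain ⟨J, hJ⟩ : ∃ J : ℕ, ∀ q ∈ S, M q ≤ 2 ^ (J + 1) := by
    obtain ⟨B, hB⟩ := (S.finite_toSet.image M).bddAbove
    obtain ⟨J, hJ⟩ := pow_unbounded_of_one_lt B (one_lt_two (α := ℝ))
    refine ⟨J, fun q hq => (hB ⟨q, hq, rfl⟩).trans (hJ.le.trans ?_)⟩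
    exact pow_le_pow_right₀ one_le_two (Nat.le_succ J)
  calc ∑ q ∈ S, M q
      ≤ ∑ q ∈ S, (2 + ∑ j ∈ Finset.range J,
          if (2 : ℝ) ^ (j + 1) < M q then (2 : ℝ) ^ (j + 1) else 0) :=
        Finset.sum_le_sum fun q hq => le_two_add_sum_dyadic (hJ q hq)
    _ = ∑ q ∈ S, 2 + ∑ j ∈ Finset.range J, (2 : ℝ) ^ (j + 1) *
          ({q ∈ S | (2 : ℝ) ^ (j + 1) < M q}).card := by
        rw [Finset.sum_add_distrib, Finset.sum_comm]
        congr 1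
        refine Finset.sum_congr rfl fun j _ => ?_
        rw [← Finset.sum_filter, Finset.sum_const, nsmul_eq_mul, mul_comm]
    _ ≤ ∑ q ∈ S, 2 + ∑ j ∈ Finset.range J, 2 * C * ∑ q ∈ S,
          (if (2 : ℝ) ^ (j + 1) < 2 * C * φ q then φ q else 0) := by
        exact add_le_add le_rfl (Finset.sum_le_sum fun j _ => hweak _ (by positivity))
    _ = ∑ q ∈ S, (2 + 2 * C * (φ q * ∑ j ∈ Finset.range J,
          if (2 : ℝ) ^ (j + 1) < 2 * C * φ q then (1 : ℝ) else 0)) := by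
        rw [Finset.sum_add_distrib, ← Finset.mul_sum, Finset.sum_comm, ← Finset.mul_sum]
        congr 2
        refine Finset.sum_congr rfl fun q _ => ?_
        rw [Finset.mul_sum]
        refine Finset.sum_congr rfl fun j _ => ?_
        split_ifs <;> simp
    _ ≤ ∑ q ∈ S, (2 + 12 * C * Real.log (2 * C) + 4 * C) *
          (1 + φ q * max (Real.log (φ q)) 0) := by
        refine Finset.sum_le_sum fun q _ => ?_
        have h1 := mul_le_mul_of_nonneg_left (sum_dyadic_indicator_le (2 * C * φ q) J) (hφ q)
        have h2 := mul_log_mul_le (a := 2 * C) (by linarith) (hφ q)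
        have h3 := mul_le_mul_of_nonneg_left h2 (by positivity : 0 ≤ 4 * C)
        have h4 := mul_le_mul_of_nonneg_left h1 (by positivity : 0 ≤ 2 * C)
        have h5 : 0 ≤ φ q * max (Real.log (φ q)) 0 :=
          mul_nonneg (hφ q) (le_max_right _ _)
        have h6 : 0 ≤ C * Real.log (2 * C) * (φ q * max (Real.log (φ q)) 0) := by positivity
        nlinarith
    _ = _ := (Finset.mul_sum _ _ _).symm

/-- The finite maximal inequality in terms of suprema over finitely many radii. -/
theorem sum_iSup_ballAvg_le {A : ℝ} {I : Finset ℕ} (hI : I.Nonempty)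
    {e : ℕ → ℝ} {φ : ι → ℝ} (hA : ∀ κ : ι → ℕ, (∀ q, κ q ∈ I) →
      ∑ q ∈ S, ballAvg S D α φ (e (κ q)) q ≤ A) (hφ : ∀ q, 0 ≤ φ q) :
    ∑ q ∈ S, ⨆ i ∈ I, ENNReal.ofReal (ballAvg S D α φ (e i) q) ≤ ENNReal.ofReal A := by
  choose κ hκ hmax using fun q => I.exists_max_image (fun i => ballAvg S D α φ (e i) q) hI
  have hnonneg : ∀ q ∈ S, 0 ≤ ballAvg S D α φ (e (κ q)) q := fun q _ =>
    mul_nonneg (by positivity) (Finset.sum_nonneg fun q' _ => hφ q')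
  calc _ ≤ ∑ q ∈ S, ENNReal.ofReal (ballAvg S D α φ (e (κ q)) q) :=
        Finset.sum_le_sum fun q _ => iSup₂_le fun i hi => ENNReal.ofReal_le_ofReal (hmax q i hi)
    _ = ENNReal.ofReal (∑ q ∈ S, ballAvg S D α φ (e (κ q)) q) :=
        (ENNReal.ofReal_sum_of_nonneg hnonneg).symm
    _ ≤ _ := ENNReal.ofReal_le_ofReal (hA κ hκ)

end FiniteMaximal

namespace IsHyperbolicMetric

variable {Γ : Type*} [Group Γ] {d : Γ → Γ → ℝ} {δ c : ℝ}

theorem of_quasiGeodesic (hzero : ∀ x y : Γ, d x y = 0 ↔ x = y)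
    (hsymm : ∀ x y : Γ, d x y = d y x)
    (htri : ∀ x y z : Γ, d x z ≤ d x y + d y z)
    (hinv : ∀ g x y : Γ, d (g * x) (g * y) = d x y)
    (hproper : ∀ R : ℝ, {g : Γ | d 1 g ≤ R}.Finite) (hδ : 0 ≤ δ)
    (hhyp : ∀ x y z w : Γ, (d x w + d y w - d x y) / 2 ≥
      min ((d x w + d z w - d x z) / 2) ((d y w + d z w - d y z) / 2) - δ)
    (hc : 0 ≤ c)
    (hqg : ∀ x y : Γ, ∃ (s t : ℝ) (γ : ℝ → Γ), s ≤ t ∧ γ s = x ∧ γ t = y ∧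
      ∀ i ∈ Set.Icc s t, ∀ j ∈ Set.Icc s t,
        |i - j| - c ≤ d (γ i) (γ j) ∧ d (γ i) (γ j) ≤ |i - j| + c) :
    IsHyperbolicMetric d δ (2 * c) where
  self x := (hzero x x).2 rfl
  symm := hsymm
  tri := htri
  inv := hinv
  proper := hproper
  hyp x y z w := by
    have h1 := hhyp x y z w
    rcases min_choice ((d x w + d z w - d x z) / 2) ((d y w + d z w - d y z) / 2) with h2 | h2 <;>
      rw [h2] at h1
    · left; linarith
    · right; linarith
  interp g t ht htg := by
    obtain ⟨s, e, γ, hse, hs, he, hγ⟩ := hqg 1 g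
    have h1 := hγ s ⟨le_rfl, hse⟩ e ⟨hse, le_rfl⟩
    rw [hs, he, abs_sub_comm, abs_of_nonneg (sub_nonneg.2 hse)] at h1
    rcases le_or_gt (s + t) e with hst | hst
    · refine ⟨γ (s + t), ?_, ?_⟩
      · have h2 := hγ s ⟨le_rfl, hse⟩ (s + t) ⟨by linarith, hst⟩
        rw [hs, abs_sub_comm, add_sub_cancel_left, abs_of_nonneg ht] at h2
        rw [abs_le]
        constructor <;> linarith [h2.1, h2.2]
      · have h2 := hγ (s + t) ⟨by linarith, hst⟩ e ⟨hse, le_rfl⟩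
        rw [he, abs_sub_comm, abs_of_nonneg (sub_nonneg.2 hst)] at h2
        rw [abs_le]
        constructor <;> linarith [h1.1, h1.2, h2.1, h2.2]
    · refine ⟨g, ?_, ?_⟩
      · rw [abs_le]
        constructor <;> linarith [h1.1, h1.2]
      · rw [(hzero g g).2 rfl, abs_le]
        constructor <;> linarith [h1.1, h1.2]
  delta_nonneg := hδ
  c_nonneg := by linarith

/-- The average of `F` over the ball of radius `r` around the identity. -/
noncomputable def centeredAvg (h : IsHyperbolicMetric d δ c) (F : Γ → ℝ) (r : ℝ) : ℝ :=
  ∑ g ∈ h.ball r, ((h.ball r).card : ℝ)⁻¹ * F g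

theorem tsum_eq_centeredAvg (h : IsHyperbolicMetric d δ c) (F : Γ → ℝ) (r : ℝ) :
    ∑' g : Γ, (if d 1 g ≤ r then ((Nat.card {x : Γ // d 1 x ≤ r} : ℝ))⁻¹ else 0) * F g =
      h.centeredAvg F r := by
  have hcard : Nat.card {x : Γ // d 1 x ≤ r} = (h.ball r).card :=
    Set.ncard_eq_toFinset_card _ (h.proper r)
  rw [hcard, tsum_eq_sum (s := h.ball r), centeredAvg]
  · refine Finset.sum_congr rfl fun g hg => ?_
    rw [if_pos (h.mem_ball.1 hg)]
  · intro g hg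
    rw [if_neg (fun hr => hg (h.mem_ball.2 hr)), zero_mul]

theorem exists_ball_eq (h : IsHyperbolicMetric d δ c) {r : ℝ} (hr : 0 ≤ r) :
    ∃ g, h.ball r = h.ball (d 1 g) := by
  obtain ⟨g, hg, hmax⟩ := (h.ball r).exists_max_image (d 1) ⟨1, h.one_mem_ball hr⟩
  exact ⟨g, Finset.Subset.antisymm (fun x hx => h.mem_ball.2 (hmax x hx))
    (h.ball_mono (h.mem_ball.1 hg))⟩

/-- Transference: ball averages are dominated by averages over a large sphere `S` of the ball
averages in `S`. -/
theorem centeredAvg_le_sum_ballAvg (h : IsHyperbolicMetric d δ c) [DecidableEq Γ] {S : Finset Γ}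
    {α : ℝ → ℕ} {C : ℝ} {r : ℝ} (hr : 0 ≤ r) (hS : S.Nonempty) (hα : 0 < α r)
    (hSα : ∀ g, d 1 g ≤ r →
      (S.card * α r : ℝ) ≤ C * (h.ball r).card * ({q ∈ S | q * g ∈ S}).card)
    {F : Γ → ℝ} (hF : ∀ g, 0 ≤ F g) :
    h.centeredAvg F r ≤ C * (S.card : ℝ)⁻¹ *
      ∑ q ∈ S, ballAvg S d α (fun q' => F (q⁻¹ * q')) r q := by
  have hSpos : (0 : ℝ) < S.card := by exact_mod_cast hS.card_pos
  have hαpos : (0 : ℝ) < α r := by exact_mod_cast hα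
  have hBpos : (0 : ℝ) < (h.ball r).card := by exact_mod_cast h.ball_card_pos hr
  have h1 : ∀ q, ∑ q' ∈ S with d q q' ≤ r, F (q⁻¹ * q') =
      ∑ g ∈ h.ball r, if q * g ∈ S then F g else 0 := by
    intro q
    rw [← Finset.sum_filter]
    refine Finset.sum_nbij' (fun q' => q⁻¹ * q') (fun g => q * g) ?_ ?_ ?_ ?_ ?_
    · intro q' hq'
      rw [Finset.mem_filter] at hq' ⊢
      rw [h.mem_ball, ← h.eq_length, mul_inv_cancel_left]
      exact hq'.symm
    · intro g hg
      rw [Finset.mem_filter, h.mem_ball] at hg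
      rw [Finset.mem_filter, h.eq_length, inv_mul_cancel_left]
      exact hg.symm
    · simp
    · simp
    · simp
  have h2 : ∑ q ∈ S, ballAvg S d α (fun q' => F (q⁻¹ * q')) r q =
      ∑ g ∈ h.ball r, (α r : ℝ)⁻¹ * (({q ∈ S | q * g ∈ S}).card * F g) := by
    simp only [ballAvg]
    rw [← Finset.mul_sum, ← Finset.mul_sum, Finset.sum_congr rfl fun q _ => h1 q,
      Finset.sum_comm]
    congr 1
    refine Finset.sum_congr rfl fun g _ => ?_
    rw [← Finset.sum_filter, Finset.sum_const, nsmul_eq_mul]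
  rw [h2, centeredAvg, Finset.mul_sum]
  refine Finset.sum_le_sum fun g hg => ?_
  have h3 := hSα g (h.mem_ball.1 hg)
  rw [← mul_assoc (α r : ℝ)⁻¹, ← mul_assoc]
  refine mul_le_mul_of_nonneg_right ?_ (hF g)
  rw [inv_le_iff_one_le_mul₀ hBpos]
  calc (1 : ℝ) = (S.card * α r) * ((S.card : ℝ)⁻¹ * (α r : ℝ)⁻¹) := by field_simp
    _ ≤ (C * (h.ball r).card * ({q ∈ S | q * g ∈ S}).card) *
        ((S.card : ℝ)⁻¹ * (α r : ℝ)⁻¹) := by gcongr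
    _ = _ := by ring

section Action

variable {X : Type*} [MeasurableSpace X] {m : Measure X}
  {T : Γ → X → X} {f : X → ℝ}

theorem measurable_ballAvg (hT : ∀ g, MeasurePreserving (T g) m m) (hf : Measurable f)
    (S : Finset Γ) (α : ℝ → ℕ) (r : ℝ) (q : Γ) :
    Measurable fun y => ballAvg S d α (fun q' => |f (T q'⁻¹ y)|) r q := by
  unfold ballAvg
  refine Measurable.const_mul (Finset.measurable_sum _ fun q' _ => ?_) _
  exact (hf.comp (hT _).measurable).abs

theorem measurable_centeredAvg (h : IsHyperbolicMetric d δ c)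
    (hT : ∀ g, MeasurePreserving (T g) m m) (hf : Measurable f) (r : ℝ) :
    Measurable fun x => h.centeredAvg (fun g => |f (T g⁻¹ x)|) r := by
  unfold centeredAvg
  refine Finset.measurable_sum _ fun g _ => Measurable.const_mul ?_ _
  exact (hf.comp (hT _).measurable).abs

/-- Transferring a finite maximal inequality on `S` to a probability-measure-preserving action. -/
theorem lintegral_iSup_centeredAvg_le [IsProbabilityMeasure m] (h : IsHyperbolicMetric d δ c)
    (hT : ∀ g, MeasurePreserving (T g) m m)
    (hmul : ∀ g k x, T (g * k) x = T g (T k x)) (hf : Measurable f)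
    {ψ : ℝ → ℝ} (hψ0 : ∀ y, 0 ≤ y → 0 ≤ ψ y) (hψm : Measurable ψ)
    (hψ : Integrable (fun x => ψ |f x|) m)
    {S : Finset Γ} (hS : S.Nonempty) {α : ℝ → ℕ} {C A : ℝ} (hC : 0 ≤ C) (hA : 0 ≤ A)
    {I : Finset ℕ} (hI : I.Nonempty) {e : ℕ → ℝ}
    (hdom : ∀ i ∈ I, ∀ F : Γ → ℝ, (∀ g, 0 ≤ F g) → h.centeredAvg F (e i) ≤
      C * (S.card : ℝ)⁻¹ * ∑ q ∈ S, ballAvg S d α (fun q' => F (q⁻¹ * q')) (e i) q)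
    (hmax : ∀ φ : Γ → ℝ, (∀ g, 0 ≤ φ g) → ∀ ι : Γ → ℕ, (∀ q, ι q ∈ I) →
      ∑ q ∈ S, ballAvg S d α φ (e (ι q)) q ≤ A * ∑ q ∈ S, (1 + ψ (φ q))) :
    ∫⁻ x, ⨆ i ∈ I, ENNReal.ofReal (h.centeredAvg (fun g => |f (T g⁻¹ x)|) (e i)) ∂m ≤
      ENNReal.ofReal (C * A * (1 + ∫ x, ψ |f x| ∂m)) := by
  have hSpos : (0 : ℝ) < S.card := by exact_mod_cast hS.card_pos
  set G : Γ → X → ENNReal := fun q y =>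
    ⨆ i ∈ I, ENNReal.ofReal (ballAvg S d α (fun q' => |f (T q'⁻¹ y)|) (e i) q) with hG
  have hGm : ∀ q, Measurable (G q) := fun q =>
    Measurable.iSup fun i => Measurable.iSup fun _ =>
      (measurable_ballAvg hT hf S α (e i) q).ennreal_ofReal
  have hGT : ∀ q, Measurable fun x => G q (T q x) := fun q => (hGm q).comp (hT q).measurable
  have hpt : ∀ x, ⨆ i ∈ I, ENNReal.ofReal (h.centeredAvg (fun g => |f (T g⁻¹ x)|) (e i)) ≤
      ENNReal.ofReal (C * (S.card : ℝ)⁻¹) * ∑ q ∈ S, G q (T q x) := by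
    intro x
    refine iSup₂_le fun i hi => ?_
    have h1 := hdom i hi (fun g => |f (T g⁻¹ x)|) fun g => abs_nonneg _
    refine (ENNReal.ofReal_le_ofReal h1).trans ?_
    rw [ENNReal.ofReal_mul (by positivity), ENNReal.ofReal_sum_of_nonneg]
    · gcongr with q hq
      have h2 : (fun q' : Γ => |f (T (q⁻¹ * q')⁻¹ x)|) = fun q' => |f (T q'⁻¹ (T q x))| := by
        funext q'
        rw [mul_inv_rev, inv_inv, hmul]
      rw [h2]
      exact le_iSup₂ (f := fun i _ => ENNReal.ofReal
        (ballAvg S d α (fun q' => |f (T q'⁻¹ (T q x))|) (e i) q)) i hi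
    · exact fun q _ => mul_nonneg (by positivity) (Finset.sum_nonneg fun q' _ => abs_nonneg _)
  have hψi : ∀ q : Γ, Integrable (fun y => ψ |f (T q⁻¹ y)|) m := fun q =>
    (hT q⁻¹).integrable_comp_of_integrable hψ
  have hadd : ∀ q : Γ, Integrable (fun y => 1 + ψ |f (T q⁻¹ y)|) m := fun q =>
    (integrable_const (1 : ℝ)).add (hψi q)
  have hint : ∀ q : Γ, ∫ y, ψ |f (T q⁻¹ y)| ∂m = ∫ x, ψ |f x| ∂m := fun q => by
    have hm : AEStronglyMeasurable (fun x => ψ |f x|) (m.map (T q⁻¹)) :=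
      (hψm.comp hf.abs).aestronglyMeasurable
    have h1 := integral_map (hT q⁻¹).measurable.aemeasurable hm
    rw [(hT q⁻¹).map_eq] at h1
    exact h1.symm
  have hsumi : Integrable (fun y => A * ∑ q ∈ S, (1 + ψ |f (T q⁻¹ y)|)) m :=
    (integrable_finsetSum _ fun q _ => hadd q).const_mul A
  calc _ ≤ ∫⁻ x, ENNReal.ofReal (C * (S.card : ℝ)⁻¹) * ∑ q ∈ S, G q (T q x) ∂m :=
        lintegral_mono hpt
    _ = ENNReal.ofReal (C * (S.card : ℝ)⁻¹) * ∑ q ∈ S, ∫⁻ x, G q (T q x) ∂m := by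
        rw [lintegral_const_mul _ (Finset.measurable_sum _ fun q _ => hGT q),
          lintegral_finsetSum _ fun q _ => hGT q]
    _ = ENNReal.ofReal (C * (S.card : ℝ)⁻¹) * ∫⁻ y, ∑ q ∈ S, G q y ∂m := by
        rw [lintegral_finsetSum _ fun q _ => hGm q]
        congr 1
        exact Finset.sum_congr rfl fun q _ => (hT q).lintegral_comp (hGm q)
    _ ≤ ENNReal.ofReal (C * (S.card : ℝ)⁻¹) *
          ∫⁻ y, ENNReal.ofReal (A * ∑ q ∈ S, (1 + ψ |f (T q⁻¹ y)|)) ∂m := by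
        gcongr with y
        exact sum_iSup_ballAvg_le hI (hmax _ fun g => abs_nonneg _) fun g => abs_nonneg _
    _ = ENNReal.ofReal (C * (S.card : ℝ)⁻¹) *
          ENNReal.ofReal (∫ y, A * ∑ q ∈ S, (1 + ψ |f (T q⁻¹ y)|) ∂m) := by
        rw [ofReal_integral_eq_lintegral_ofReal hsumi]
        exact Eventually.of_forall fun y => mul_nonneg hA
          (Finset.sum_nonneg fun q _ => add_nonneg zero_le_one (hψ0 _ (abs_nonneg _)))
    _ = _ := by
        rw [← ENNReal.ofReal_mul (by positivity), integral_const_mul,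
          integral_finsetSum _ fun q _ => hadd q]
        congr 1
        have h3 : ∀ q ∈ S, ∫ y, (1 + ψ |f (T q⁻¹ y)|) ∂m = 1 + ∫ x, ψ |f x| ∂m := by
          intro q _
          rw [integral_add (integrable_const _) (hψi q), hint q]
          simp
        rw [Finset.sum_congr rfl h3, Finset.sum_const, nsmul_eq_mul]
        field_simp

end Action

end IsHyperbolicMetric

theorem stmt_1
    {Γ : Type} [Group Γ] [Countable Γ] (d : Γ → Γ → ℝ)
    (hzero : ∀ x y : Γ, d x y = 0 ↔ x = y)
    (hsymm : ∀ x y : Γ, d x y = d y x)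
    (htri : ∀ x y z : Γ, d x z ≤ d x y + d y z)
    (hinv : ∀ g x y : Γ, d (g * x) (g * y) = d x y)
    (hproper : ∀ R : ℝ, {g : Γ | d 1 g ≤ R}.Finite)
    (hhyp : ∃ δ : ℝ, 0 ≤ δ ∧ ∀ x y z w : Γ,
      (d x w + d y w - d x y) / 2 ≥
        min ((d x w + d z w - d x z) / 2) ((d y w + d z w - d y z) / 2) - δ)
    (hqg : ∃ c : ℝ, 0 < c ∧ ∀ x y : Γ, ∃ (s t : ℝ) (γ : ℝ → Γ), s ≤ t ∧ γ s = x ∧ γ t = y ∧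
      ∀ i ∈ Set.Icc s t, ∀ j ∈ Set.Icc s t,
        |i - j| - c ≤ d (γ i) (γ j) ∧ d (γ i) (γ j) ≤ |i - j| + c)
    (hinfinite : Infinite Γ)
    (hnonelem : ¬ ∃ H : Subgroup Γ, H.FiniteIndex ∧ IsCyclic H)
    :
    ∃ C : ℝ, 0 < C ∧
      ∀ (X : Type) [MeasurableSpace X] [StandardBorelSpace X]
        (m : Measure X) [IsProbabilityMeasure m] (T : Γ → X → X),
        (∀ g : Γ, MeasurePreserving (T g) m m) →
        (∀ x : X, T 1 x = x) →
        (∀ g h : Γ, ∀ x : X, T (g * h) x = T g (T h x)) →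
        ∀ f : X → ℝ, Measurable f →
        Integrable (fun x => |f x| * max (Real.log |f x|) 0) m →
        ∫⁻ x, (⨆ (r : ℝ) (_ : 0 < r), ENNReal.ofReal
            (∑' g : Γ, (if d 1 g ≤ r then ((Nat.card {h : Γ // d 1 h ≤ r} : ℝ))⁻¹ else 0)
              * |f (T g⁻¹ x)|)) ∂m
          ≤ ENNReal.ofReal (C * (1 + ∫ x, |f x| * max (Real.log |f x|) 0 ∂m)) := by
  classical
  obtain ⟨δ, hδ, hhyp⟩ := hhyp
  obtain ⟨c, hc, hqg⟩ := hqg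
  have h := IsHyperbolicMetric.of_quasiGeodesic hzero hsymm htri hinv hproper hδ hhyp hc.le hqg
  obtain ⟨α, S, C, k, N₀, hk, hα, hSne, htrans, hultra, hcount⟩ :=
    h.exists_sphere_estimates hnonelem
  set C' : ℝ := max C 1 with hC'
  have hC1 : 1 ≤ C' := le_max_right _ _
  have hCC : (C : ℝ) ≤ C' := le_max_left _ _
  have hlog : 0 ≤ Real.log (2 * C') := Real.log_nonneg (by linarith)
  have hA : 0 < 2 + 12 * C' * Real.log (2 * C') + 4 * C' := by positivity
  refine ⟨C' * (2 + 12 * C' * Real.log (2 * C') + 4 * C'), by positivity, ?_⟩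
  intro X _ _ m _ T hT _ hmul f hf hfi
  obtain ⟨γ, hγ⟩ := exists_surjective_nat Γ
  have he0 : ∀ i, 0 ≤ d 1 (γ i) := fun i => h.nonneg _ _
  set M : ℕ → X → ENNReal := fun n x => ⨆ i ∈ Finset.range (n + 1),
    ENNReal.ofReal (h.centeredAvg (fun g => |f (T g⁻¹ x)|) (d 1 (γ i))) with hM
  have hMbound : ∀ n, ∫⁻ x, M n x ∂m ≤ ENNReal.ofReal
      (C' * (2 + 12 * C' * Real.log (2 * C') + 4 * C') *
        (1 + ∫ x, |f x| * max (Real.log |f x|) 0 ∂m)) := by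
    intro n
    obtain ⟨R, hR0, hR⟩ : ∃ R : ℝ, 0 ≤ R ∧ ∀ i ∈ Finset.range (n + 1), d 1 (γ i) ≤ R :=
      ⟨∑ i ∈ Finset.range (n + 1), d 1 (γ i), Finset.sum_nonneg fun i _ => he0 i,
        fun i hi => Finset.single_le_sum (f := fun i => d 1 (γ i)) (fun i _ => he0 i) hi⟩
    set N := max R N₀
    have hRN : R ≤ N := le_max_left _ _
    have hN₀ : N₀ ≤ N := le_max_right _ _
    have hcount' : ∀ r, 0 ≤ r → r ≤ R → ∀ q ∈ S N, ∀ P ⊆ S N,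
        (∀ q' ∈ P, d q q' ≤ r + 1 + k) → (P.card : ℝ) ≤ C' * α r := by
      intro r hr hrR q hq P hP hPq
      have h1 : (P.card : ℝ) ≤ C * α r := by
        exact_mod_cast hcount N r hN₀ hr (hrR.trans hRN) q hq P hP hPq
      exact h1.trans (by gcongr)
    refine h.lintegral_iSup_centeredAvg_le (ψ := fun y => y * max (Real.log y) 0)
      (α := α) (C := C') (A := 2 + 12 * C' * Real.log (2 * C') + 4 * C') (S := S N)
      (I := Finset.range (n + 1)) (e := fun i => d 1 (γ i)) hT hmul hf
      (fun y hy => mul_nonneg hy (le_max_right _ _))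
      (measurable_id.mul (Real.measurable_log.max measurable_const)) hfi
      (hSne N (hR0.trans hRN)) (by linarith) hA.le (by simp) (fun i hi F hF => ?_)
      fun φ hφ ι hι => ?_
    · refine h.centeredAvg_le_sum_ballAvg (he0 i) (hSne N (hR0.trans hRN)) (hα _ (he0 i))
        (fun g hg => ?_) hF
      have h1 : ((S N).card * α (d 1 (γ i)) : ℝ) ≤
          C * (h.ball (d 1 (γ i))).card * ({q ∈ S N | q * g ∈ S N}).card := by
        exact_mod_cast htrans N _ g hN₀ ((hR i hi).trans hRN) hg
      exact h1.trans (by gcongr)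
    · exact sum_ballAvg_le h.self h.symm hα hk (hultra N) hC1 hcount' hφ
        (ρ := fun q => d 1 (γ (ι q))) (fun _ => he0 _) (fun q => hR _ (hι q))
  have hMm : ∀ n, Measurable (M n) := fun n => Measurable.iSup fun i => Measurable.iSup fun _ =>
    (h.measurable_centeredAvg hT hf _).ennreal_ofReal
  have hMmono : Monotone M := fun n n' hn x =>
    biSup_mono fun i hi => Finset.range_mono (Nat.succ_le_succ hn) hi
  have hpt : ∀ x, (⨆ (r : ℝ) (_ : 0 < r), ENNReal.ofReal
      (∑' g : Γ, (if d 1 g ≤ r then ((Nat.card {h : Γ // d 1 h ≤ r} : ℝ))⁻¹ else 0)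
        * |f (T g⁻¹ x)|)) ≤ ⨆ n, M n x := by
    intro x
    refine iSup₂_le fun r hr => ?_
    rw [h.tsum_eq_centeredAvg (fun g => |f (T g⁻¹ x)|) r]
    obtain ⟨g, hg⟩ := h.exists_ball_eq hr.le
    obtain ⟨i, rfl⟩ := hγ g
    have h1 : h.centeredAvg (fun g => |f (T g⁻¹ x)|) r =
        h.centeredAvg (fun g => |f (T g⁻¹ x)|) (d 1 (γ i)) := by
      unfold IsHyperbolicMetric.centeredAvg
      rw [hg]
    rw [h1]
    exact (le_iSup₂ (f := fun j (_ : j ∈ Finset.range (i + 1)) => ENNReal.ofReal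
      (h.centeredAvg (fun g => |f (T g⁻¹ x)|) (d 1 (γ j)))) i
      (Finset.self_mem_range_succ i)).trans (le_iSup (fun n => M n x) i)
  refine (lintegral_mono hpt).trans ?_
  rw [lintegral_iSup hMm hMmono]
  exact iSup_le hMbound
end

section
/- Let (X,d) be a metric space and δ ≥ 0 be such that the Gromov product (x|y)_z := (1/2)(d(x,z)+d(y,z)−d(x,y)) satisfies (x|y)_w ≥ min{(x|z)_w,(y|z)_w} − δ for all x,y,z,w ∈ X. Let x_0, w ∈ X and let {y_i}, {z_i} be sequences in X with lim_{i,j→∞} (y_i|y_j)_{x_0} = ∞, lim_{i,j→∞} (z_i|z_j)_{x_0} = ∞, and lim_{i→∞} (y_i|z_i)_{x_0} = ∞ (i.e. {y_i} and {z_i} are equivalent Gromov sequences). Then limsup_{i→∞} | ( d(y_i,w) − d(y_i,x_0) ) − ( d(z_i,w) − d(z_i,x_0) ) | ≤ 4δ. -/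
open Filter

theorem stmt_10
    {X : Type} [MetricSpace X] (δ : ℝ) (hδ : 0 ≤ δ)
    -- (x|y)_w ≥ min{(x|z)_w, (y|z)_w} − δ for all x,y,z,w
    (hhyp : ∀ x y z w : X,
      (dist x w + dist y w - dist x y) / 2 ≥
        min ((dist x w + dist z w - dist x z) / 2)
            ((dist y w + dist z w - dist y z) / 2) - δ)
    (x₀ w : X) (y z : ℕ → X)
    -- {y_i} and {z_i} are Gromov sequences
    (hy : Tendsto (fun ij : ℕ × ℕ =>
      (dist (y ij.1) x₀ + dist (y ij.2) x₀ - dist (y ij.1) (y ij.2)) / 2) atTop atTop)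
    (hz : Tendsto (fun ij : ℕ × ℕ =>
      (dist (z ij.1) x₀ + dist (z ij.2) x₀ - dist (z ij.1) (z ij.2)) / 2) atTop atTop)
    -- they are equivalent
    (hyz : Tendsto (fun i : ℕ =>
      (dist (y i) x₀ + dist (z i) x₀ - dist (y i) (z i)) / 2) atTop atTop) :
    -- limsup_i |(d(y_i,w) − d(y_i,x₀)) − (d(z_i,w) − d(z_i,x₀))| ≤ 4δ
    ∀ ε : ℝ, 0 < ε → ∀ᶠ i : ℕ in atTop,
      |(dist (y i) w - dist (y i) x₀) - (dist (z i) w - dist (z i) x₀)| ≤ 4 * δ + ε := by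
  intro ε hε
  filter_upwards [hyz.eventually_ge_atTop (dist w x₀)] with i hi
  have hyw := hhyp (y i) w (z i) x₀
  have hzw := hhyp (z i) w (y i) x₀
  have hzt := dist_triangle (z i) w x₀
  have hyt := dist_triangle (y i) w x₀
  rw [dist_comm w (z i)] at hyw
  rw [dist_comm w (y i), dist_comm (z i) (y i)] at hzw
  rw [min_eq_right (by linarith)] at hyw hzw
  rw [abs_le]
  constructor <;> linarith
end

section
/- Let (Γ,d) be a non-elementary uniformly quasi-geodesic hyperbolic group. Then there exist constants v > 0 and C > 0 such that for every g ∈ Γ and every r > 0, C^{-1} e^{v r} ≤ |B(g,r)| ≤ C e^{v r}, where B(g,r) = {h ∈ Γ : d(g,h) ≤ r} and |·| denotes cardinality. -/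
open MeasureTheory Filter Set

/-- A proper left-invariant metric on a group that is `δ`-hyperbolic and
roughly geodesic with additive error `c`. -/
structure IsRoughGeodesicHyperbolic {Γ : Type} [Group Γ] (d : Γ → Γ → ℝ) (δ c : ℝ) : Prop where
  self : ∀ x, d x x = 0
  symm : ∀ x y, d x y = d y x
  tri : ∀ x y z, d x z ≤ d x y + d y z
  inv : ∀ g x y, d (g * x) (g * y) = d x y
  proper : ∀ R : ℝ, {g : Γ | d 1 g ≤ R}.Finite
  delta_nonneg : 0 ≤ δ
  one_le : 1 ≤ c
  four_point : ∀ x y z w, d x y + d z w ≤ d x z + d y w + 2 * δ ∨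
    d x y + d z w ≤ d y z + d x w + 2 * δ
  rough : ∀ x y T, 0 ≤ T → T ≤ d x y → ∃ u, T - c ≤ d x u ∧ d x u ≤ T + c ∧
    d x y - T - c ≤ d u y ∧ d u y ≤ d x y - T + c

/-- The Gromov product of `x` and `y` based at the identity. -/
noncomputable def gromovProd {Γ : Type} [Group Γ] (d : Γ → Γ → ℝ) (x y : Γ) : ℝ :=
  (d 1 x + d 1 y - d x y) / 2

namespace IsRoughGeodesicHyperbolic

variable {Γ : Type} [Group Γ] {d : Γ → Γ → ℝ} {δ c : ℝ}

lemma nonneg (h : IsRoughGeodesicHyperbolic d δ c) (x y : Γ) : 0 ≤ d x y := by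
  have := h.tri x y x
  rw [h.self, h.symm y x] at this
  linarith

lemma dist_one_mul (h : IsRoughGeodesicHyperbolic d δ c) (f x : Γ) :
    d 1 (f * x) = d f⁻¹ x := by
  rw [← h.inv f f⁻¹ x, mul_inv_cancel]

lemma dist_one_inv (h : IsRoughGeodesicHyperbolic d δ c) (f : Γ) : d 1 f⁻¹ = d 1 f := by
  rw [← h.inv f, mul_inv_cancel, mul_one, h.symm]

lemma dist_one_mul_le (h : IsRoughGeodesicHyperbolic d δ c) (f x : Γ) :
    d 1 (f * x) ≤ d 1 f + d 1 x := by
  have := h.tri 1 f (f * x)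
  have h2 := h.inv f 1 x
  rw [mul_one] at h2
  linarith

lemma le_dist_one_mul (h : IsRoughGeodesicHyperbolic d δ c) (f x : Γ) :
    d 1 x - d 1 f ≤ d 1 (f * x) := by
  have := h.dist_one_mul_le f⁻¹ (f * x)
  rw [inv_mul_cancel_left, h.dist_one_inv] at this
  linarith

lemma gromovProd_comm (h : IsRoughGeodesicHyperbolic d δ c) (x y : Γ) :
    gromovProd d x y = gromovProd d y x := by
  simp only [gromovProd, h.symm x y]; ring

lemma gromovProd_le_right (h : IsRoughGeodesicHyperbolic d δ c) (x y : Γ) :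
    gromovProd d x y ≤ d 1 y := by
  have := h.tri 1 y x
  rw [h.symm y x] at this
  unfold gromovProd; linarith

lemma gromovProd_ge (h : IsRoughGeodesicHyperbolic d δ c) (x y z : Γ) :
    min (gromovProd d x z) (gromovProd d z y) - δ ≤ gromovProd d x y := by
  unfold gromovProd
  have := h.symm y 1
  have := h.symm x 1
  have := h.symm z 1
  have := h.symm z y
  rcases h.four_point x y z 1 with h1 | h1
  · linarith [min_le_left ((d 1 x + d 1 z - d x z) / 2) ((d 1 z + d 1 y - d z y) / 2)]
  · linarith [min_le_right ((d 1 x + d 1 z - d x z) / 2) ((d 1 z + d 1 y - d z y) / 2)]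

lemma gromovProd_mul_mul (h : IsRoughGeodesicHyperbolic d δ c) (f x y : Γ) :
    gromovProd d x y - d 1 f ≤ gromovProd d (f * x) (f * y) := by
  unfold gromovProd
  have := h.le_dist_one_mul f x
  have := h.le_dist_one_mul f y
  rw [h.inv]
  linarith

/-- Points with a large Gromov product have nearly equal Busemann cocycles. -/
lemma sub_le_sub_of_gromovProd (h : IsRoughGeodesicHyperbolic d δ c) {x y p q : Γ}
    (hpq : d 1 x + d 1 y + δ < gromovProd d p q) :
    d x p - d y p ≤ d x q - d y q + 2 * δ := by
  unfold gromovProd at hpq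
  have h1 := h.tri x 1 y
  have h2 := h.tri 1 x p
  have h3 := h.tri 1 y q
  rw [h.symm x 1] at h1
  rcases h.four_point x p y q with h4 | h4
  · linarith [h.symm p y, h.symm p q]
  · linarith [h.symm p y, h.symm p q]

section FixedEnd

variable {x : ℕ → Γ} {U : Ultrafilter ℕ}

/-- The elements fixing the end represented by the sequence `x` along `U`. -/
def endStabilizer (h : IsRoughGeodesicHyperbolic d δ c)
    (hx : Tendsto (fun n => d 1 (x n)) U atTop) : Subgroup Γ where
  carrier := {f | Tendsto (fun n => gromovProd d (f * x n) (x n)) U atTop}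
  one_mem' := by
    have : (fun n => gromovProd d (1 * x n) (x n)) = fun n => d 1 (x n) := by
      funext n; simp [gromovProd, h.self]
    simpa only [mem_ofPred_eq, this] using hx
  mul_mem' := by
    intro f g hf hg
    simp only [mem_ofPred_eq, tendsto_atTop] at hf hg ⊢
    intro M
    filter_upwards [hf (M + δ), hg (M + δ + d 1 f)] with n h1 h2
    have h3 := h.gromovProd_mul_mul f (g * x n) (x n)
    have h4 := h.gromovProd_ge (f * g * x n) (x n) (f * x n)
    rw [mul_assoc] at h4 ⊢
    have : M + δ ≤ min (gromovProd d (f * (g * x n)) (f * x n)) (gromovProd d (f * x n) (x n)) :=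
      le_min (by linarith) h1
    linarith
  inv_mem' := by
    intro f hf
    simp only [mem_ofPred_eq, tendsto_atTop] at hf ⊢
    intro M
    filter_upwards [hf (M + d 1 f)] with n h1
    have h3 := h.gromovProd_mul_mul f⁻¹ (f * x n) (x n)
    rw [inv_mul_cancel_left, h.dist_one_inv] at h3
    rw [h.gromovProd_comm]
    linarith

lemma mem_endStabilizer (h : IsRoughGeodesicHyperbolic d δ c)
    (hx : Tendsto (fun n => d 1 (x n)) U atTop) {f : Γ} :
    f ∈ h.endStabilizer hx ↔ Tendsto (fun n => gromovProd d (f * x n) (x n)) U atTop := Iff.rfl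

lemma finiteIndex_endStabilizer (h : IsRoughGeodesicHyperbolic d δ c) (hU : (U : Filter ℕ) ≤ atTop)
    (hx : Tendsto (fun n => d 1 (x n)) U atTop) {k : ℕ} {A : ℕ → Finset Γ}
    (hk : ∀ n, (A n).card ≤ k)
    (hA : ∀ (n : ℕ) f, d 1 f ≤ n → ∃ a ∈ A n, (n : ℝ) < gromovProd d a (f * x n)) :
    (h.endStabilizer hx).FiniteIndex := by
  suffices hfin : Finite (Γ ⧸ h.endStabilizer hx) from Subgroup.finiteIndex_of_finite_quotient
  by_contra hinf
  rw [not_finite_iff_infinite] at hinf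
  obtain ⟨e⟩ : Nonempty (Fin (k + 1) ↪ Γ ⧸ h.endStabilizer hx) :=
    ⟨(Fin.valEmbedding).trans (Infinite.natEmbedding _)⟩
  set r : Fin (k + 1) → Γ := fun i => (e i).out with hr
  have hlarge : ∀ᶠ n : ℕ in U, ∀ i, d 1 (r i) ≤ n := by
    rw [eventually_all]
    exact fun i => hU (tendsto_natCast_atTop_atTop.eventually_ge_atTop _)
  have hpair : ∀ᶠ n : ℕ in U, ∃ i j, i ≠ j ∧ (n : ℝ) - δ ≤ gromovProd d (r i * x n) (r j * x n) := by
    filter_upwards [hlarge] with n hn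
    choose a ha ha' using fun i => hA n (r i) (hn i)
    obtain ⟨i, -, j, -, hij, heq⟩ := Finset.exists_ne_map_eq_of_card_lt_of_maps_to
      (s := Finset.univ) (t := A n) (f := a) (by simpa using Nat.lt_succ_of_le (hk n))
      (fun i _ => ha i)
    refine ⟨i, j, hij, ?_⟩
    have h1 := ha' i
    have h2 := ha' j
    rw [← heq] at h2
    rw [h.gromovProd_comm] at h1
    have h3 := h.gromovProd_ge (r i * x n) (r j * x n) (a i)
    have := (lt_min h1 h2).le
    linarith
  simp only [Ultrafilter.eventually_exists_iff] at hpair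
  obtain ⟨i, j, hij⟩ := hpair
  have hne : i ≠ j := (hij.exists).choose_spec.1
  apply hne
  apply e.injective
  have : (r i)⁻¹ * r j ∈ h.endStabilizer hx := by
    rw [mem_endStabilizer, tendsto_atTop]
    intro M
    filter_upwards [hij, hU (tendsto_natCast_atTop_atTop.eventually_ge_atTop (M + δ + d 1 (r i)))]
      with n h1 h2
    have h3 := h.gromovProd_mul_mul (r i)⁻¹ (r i * x n) (r j * x n)
    rw [inv_mul_cancel_left, h.dist_one_inv, ← mul_assoc] at h3
    rw [h.gromovProd_comm]
    linarith [h1.2]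
  rw [← QuotientGroup.eq] at this
  simpa [hr] using this

lemma exists_busemann (h : IsRoughGeodesicHyperbolic d δ c) (x : ℕ → Γ) (U : Ultrafilter ℕ) :
    ∃ b : Γ → ℝ, ∀ g, Tendsto (fun n => d g (x n) - d 1 (x n)) U (nhds (b g)) := by
  have (g : Γ) : ∃ b, Tendsto (fun n => d g (x n) - d 1 (x n)) U (nhds b) := by
    obtain ⟨b, -, hb⟩ := (isCompact_Icc (a := -d 1 g) (b := d 1 g)).ultrafilter_le_nhds
      (U.map fun n => d g (x n) - d 1 (x n)) (by
        rw [le_principal_iff]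
        refine Filter.mem_map.2 (Filter.Eventually.of_forall fun n => ?_)
        have h1 := h.tri 1 g (x n)
        have h2 := h.tri g 1 (x n)
        rw [h.symm g 1] at h2
        constructor <;> linarith)
    exact ⟨b, hb⟩
  exact ⟨fun g => (this g).choose, fun g => (this g).choose_spec⟩

lemma busemann_mul (h : IsRoughGeodesicHyperbolic d δ c)
    (hx : Tendsto (fun n => d 1 (x n)) U atTop) {b : Γ → ℝ}
    (hb : ∀ g, Tendsto (fun n => d g (x n) - d 1 (x n)) U (nhds (b g)))
    {f : Γ} (hf : f ∈ h.endStabilizer hx) (y : Γ) :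
    |b (f * y) - b f - b y| ≤ 2 * δ := by
  have hlim := (((hb (f * y)).sub (hb f)).sub (hb y)).abs
  refine le_of_tendsto hlim ?_
  filter_upwards [hf.eventually_gt_atTop (d 1 (f * y) + d 1 f + δ)] with n hn
  have h1 := h.sub_le_sub_of_gromovProd hn
  rw [h.gromovProd_comm] at hn
  have h2 := h.sub_le_sub_of_gromovProd hn
  have h3 := h.inv f 1 (x n)
  rw [mul_one] at h3
  rw [h.inv, h3] at h1 h2
  rw [abs_le]
  constructor <;> linarith

/-- Conjugating by a point far towards the end brings a level set of the Busemann function into a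
ball of controlled radius. -/
lemma finite_busemann_fiber (h : IsRoughGeodesicHyperbolic d δ c)
    (hx : Tendsto (fun n => d 1 (x n)) U atTop) {b : Γ → ℝ}
    (hb : ∀ g, Tendsto (fun n => d g (x n) - d 1 (x n)) U (nhds (b g))) (K : ℝ) :
    {g | g ∈ h.endStabilizer hx ∧ |b g| ≤ K}.Finite := by
  set R : ℝ := 4 * K + 4 + 4 * c + 8 * δ with hR
  by_contra hinf
  obtain ⟨G, hG, hcard⟩ := Set.Infinite.exists_subset_card_eq hinf ((h.proper R).toFinset.card + 1)
  obtain ⟨M, hM⟩ : ∃ M, ∀ g ∈ G, d 1 g ≤ M := by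
    obtain ⟨M, hM⟩ := (G.image fun g => d 1 g).bddAbove
    exact ⟨M, fun g hg => hM (Finset.mem_coe.2 (Finset.mem_image_of_mem _ hg))⟩
  set T : ℝ := |M| + 2 * |K| + 4 * c + 4 * δ + 4 with hT
  have hc := h.one_le
  have hδ := h.delta_nonneg
  have hT0 : 0 ≤ T := by positivity
  have hMM := le_abs_self M
  have hKK := le_abs_self K
  have hev : ∀ᶠ n in U, T ≤ d 1 (x n) ∧ ∀ g ∈ G, |d g (x n) - d 1 (x n)| ≤ K + 1 ∧
      2 * M + T + c + δ < gromovProd d (g * x n) (x n) - M := by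
    refine (hx.eventually_ge_atTop T).and ?_
    rw [Filter.eventually_all_finset]
    intro g hg
    refine ((hb g).abs.eventually_le_const ?_).and ?_
    · linarith [(hG hg).2]
    · filter_upwards [(hG hg).1.eventually_gt_atTop (2 * M + T + c + δ + M)] with n hn
      linarith
  obtain ⟨n, hn1, hn2⟩ := hev.exists
  set p := x n
  obtain ⟨u, hu1, hu2, hu3, hu4⟩ := h.rough 1 p T hT0 hn1
  have key : ∀ g ∈ G, d 1 (u⁻¹ * g * u) ≤ R := by
    intro g hg
    obtain ⟨h1, h2⟩ := hn2 g hg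
    rw [abs_le] at h1
    have hgM := hM g hg
    have hg0 := h.nonneg 1 g
    have h3 := h.dist_one_mul_le g u
    have h4 : d (g * u) (g * p) - d g (g * p) ≤ d (g * u) p - d g p + 2 * δ :=
      h.sub_le_sub_of_gromovProd (by linarith)
    have h5 : d (g * u) p - d g p ≤ d (g * u) (g * p) - d g (g * p) + 2 * δ :=
      h.sub_le_sub_of_gromovProd (by rw [h.gromovProd_comm]; linarith)
    have h6 := h.inv g 1 p
    have h7 := h.inv g 1 u
    rw [mul_one] at h6 h7
    rw [h.inv, h6] at h4 h5
    have h8 : d 1 (u⁻¹ * g * u) = d u (g * u) := by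
      rw [mul_assoc, h.dist_one_mul, inv_inv]
    rw [h8]
    have := h.symm (g * u) u
    have := h.symm (g * u) g
    have := h.symm (g * u) 1
    have := h.symm u 1
    have := h.symm g 1
    rcases h.four_point u (g * u) 1 p with h9 | h9
    · linarith
    · rcases h.four_point (g * u) 1 g p with h10 | h10
      · linarith
      · linarith
  have hle : G.card ≤ (h.proper R).toFinset.card := by
    refine Finset.card_le_card_of_injOn (fun g => u⁻¹ * g * u) (fun g hg => ?_) ?_
    · simpa using key g hg
    · intro g _ g' _ hgg
      simpa using hgg
  omega

end FixedEnd

lemma exists_dist_gt (h : IsRoughGeodesicHyperbolic d δ c) [Infinite Γ] (R : ℝ) :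
    ∃ g, R < d 1 g := by
  obtain ⟨g, hg⟩ := (h.proper R).exists_notMem
  exact ⟨g, not_le.1 hg⟩

/-- A finite-index subgroup with a real quasimorphism all of whose level sets are finite makes the
group virtually cyclic. -/
lemma _root_.exists_finiteIndex_isCyclic_of_quasimorphism [Infinite Γ] {H : Subgroup Γ}
    (hH : H.FiniteIndex) {b : Γ → ℝ} {D : ℝ}
    (hb : ∀ f ∈ H, ∀ y, |b (f * y) - b f - b y| ≤ D)
    (hfin : ∀ K, {g | g ∈ H ∧ |b g| ≤ K}.Finite) :
    ∃ Z : Subgroup Γ, Z.FiniteIndex ∧ IsCyclic Z := by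
  have hHinf : (H : Set Γ).Infinite := by
    intro hf
    have : Finite H := hf
    have := H.finite_quotient_of_finiteIndex
    have : Finite Γ := Finite.of_equiv _ (Subgroup.groupEquivQuotientProdSubgroup (s := H)).symm
    exact not_finite Γ
  obtain ⟨t, htH, ht⟩ : ∃ t ∈ H, D + 1 ≤ b t := by
    obtain ⟨t, htH, ht⟩ := hHinf.exists_notMem_finite (hfin (3 * D + 1))
    have htH' : t ∈ H := htH
    have ht' : 3 * D + 1 < |b t| := by
      by_contra hcon
      exact ht ⟨htH', not_lt.1 hcon⟩
    rcases lt_abs.1 ht' with h1 | h1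
    · have := (abs_nonneg _).trans (hb t htH t)
      exact ⟨t, htH, by linarith⟩
    · refine ⟨t⁻¹, H.inv_mem htH, ?_⟩
      have h2 := abs_le.1 (hb t htH t⁻¹)
      have h3 := abs_le.1 (hb 1 H.one_mem 1)
      rw [mul_inv_cancel] at h2
      rw [mul_one] at h3
      linarith [h2.1, h3.1, h3.2]
  set K := b t + D with hK
  have hstep (y : Γ) : b y + 1 ≤ b (t * y) ∧ b (t * y) ≤ b y + K := by
    have := abs_le.1 (hb t htH y)
    constructor <;> linarith [this.1, this.2]
  have hwalk (g : Γ) : ∃ m : ℤ, |b (t ^ m * g)| ≤ K := by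
    rcases le_total 0 (b g) with h0 | h0
    · have hex : ∃ m : ℕ, b (t ^ (-(m : ℤ)) * g) ≤ 0 := by
        have hlin (m : ℕ) : b (t ^ (-(m : ℤ)) * g) ≤ b g - m := by
          induction m with
          | zero => simp
          | succ m ih =>
            have := (hstep (t ^ (-((m + 1 : ℕ) : ℤ)) * g)).1
            rw [← mul_assoc, ← zpow_one_add] at this
            rw [show 1 + -((m + 1 : ℕ) : ℤ) = -(m : ℤ) by push_cast; ring] at this
            push_cast at this ⊢
            linarith
        obtain ⟨m, hm⟩ := exists_nat_ge (b g)
        exact ⟨m, by linarith [hlin m]⟩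
      classical
      refine ⟨-(Nat.find hex : ℤ), ?_⟩
      have hspec := Nat.find_spec hex
      rcases hfd : Nat.find hex with _ | m
      · rw [hfd] at hspec
        have h1 := hstep g
        simp only [Nat.cast_zero, neg_zero, zpow_zero, one_mul] at hspec ⊢
        rw [abs_le]; constructor <;> linarith [h1.1, h1.2]
      · rw [hfd] at hspec
        have hmin := Nat.find_min hex (m := m) (by omega)
        have := (hstep (t ^ (-((m + 1 : ℕ) : ℤ)) * g)).2
        rw [← mul_assoc, ← zpow_one_add] at this
        rw [show 1 + -((m + 1 : ℕ) : ℤ) = -(m : ℤ) by push_cast; ring] at this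
        rw [abs_le]; constructor <;> linarith
    · have hex : ∃ m : ℕ, 0 ≤ b (t ^ m * g) := by
        have hlin (m : ℕ) : b g + m ≤ b (t ^ m * g) := by
          induction m with
          | zero => simp
          | succ m ih =>
            have := (hstep (t ^ m * g)).1
            rw [← mul_assoc, ← pow_succ'] at this
            push_cast
            linarith
        obtain ⟨m, hm⟩ := exists_nat_ge (-b g)
        exact ⟨m, by linarith [hlin m]⟩
      classical
      refine ⟨(Nat.find hex : ℤ), ?_⟩
      have hspec := Nat.find_spec hex
      rw [zpow_natCast]
      rcases hfd : Nat.find hex with _ | m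
      · rw [hfd] at hspec
        have h1 := hstep g
        simp only [pow_zero, one_mul] at hspec ⊢
        rw [abs_le]; constructor <;> linarith [h1.1, h1.2]
      · rw [hfd] at hspec
        have hmin := Nat.find_min hex (m := m) (by omega)
        have := (hstep (t ^ m * g)).2
        rw [← mul_assoc, ← pow_succ'] at this
        rw [abs_le]; constructor <;> linarith
  refine ⟨Subgroup.zpowers t, ?_, inferInstance⟩
  suffices hfq : Finite (Γ ⧸ Subgroup.zpowers t) from Subgroup.finiteIndex_of_finite_quotient
  have := H.finite_quotient_of_finiteIndex
  have := (hfin K).to_subtype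
  refine Finite.of_surjective
    (fun q : (Γ ⧸ H) × {g | g ∈ H ∧ |b g| ≤ K} =>
      (QuotientGroup.mk (q.1.out * (q.2 : Γ)⁻¹) : Γ ⧸ Subgroup.zpowers t)) ?_
  intro q
  obtain ⟨g, rfl⟩ := QuotientGroup.mk_surjective q
  set r := (QuotientGroup.mk g : Γ ⧸ H).out with hr
  have hrg : r⁻¹ * g ∈ H := by
    rw [← QuotientGroup.eq]
    simp [hr]
  obtain ⟨m, hm⟩ := hwalk (r⁻¹ * g)⁻¹
  refine ⟨⟨QuotientGroup.mk g, t ^ m * (r⁻¹ * g)⁻¹,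
    H.mul_mem (H.zpow_mem htH m) (H.inv_mem hrg), hm⟩, ?_⟩
  rw [QuotientGroup.eq]
  refine ⟨m, ?_⟩
  simp only [← hr]
  group

/-- In a group that is not virtually cyclic, any point can be moved by a bounded element so that it
points away from `k` prescribed points. -/
lemma exists_extension (h : IsRoughGeodesicHyperbolic d δ c) [Infinite Γ]
    (hnonelem : ¬ ∃ H : Subgroup Γ, H.FiniteIndex ∧ IsCyclic H) (k : ℕ) :
    ∃ C N : ℝ, 0 ≤ C ∧ 0 ≤ N ∧ ∀ A : Finset Γ, A.card ≤ k → ∀ x, ∃ f, d 1 f ≤ N ∧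
      ∀ a ∈ A, gromovProd d a (f * x) ≤ C := by
  by_contra! hcon
  choose A hk x hA using fun n : ℕ => hcon n n n.cast_nonneg n.cast_nonneg
  apply hnonelem
  let U : Ultrafilter ℕ := hyperfilter ℕ
  have hU : (U : Filter ℕ) ≤ atTop := Nat.hyperfilter_le_atTop
  have hx : Tendsto (fun n => d 1 (x n)) U atTop := by
    refine tendsto_atTop_mono (fun n => ?_) (tendsto_natCast_atTop_atTop.mono_left hU)
    obtain ⟨a, -, ha⟩ := hA n 1 (by rw [h.self]; exact n.cast_nonneg)
    rw [one_mul] at ha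
    exact ha.le.trans (h.gromovProd_le_right _ _)
  obtain ⟨b, hb⟩ := h.exists_busemann x U
  exact exists_finiteIndex_isCyclic_of_quasimorphism (h.finiteIndex_endStabilizer hU hx hk hA)
    (fun f hf y => h.busemann_mul hx hb hf y) (h.finite_busemann_fiber hx hb)

/-- The number of elements of length at most `r`. -/
noncomputable def _root_.ballCard (d : Γ → Γ → ℝ) (r : ℝ) : ℕ := {g | d 1 g ≤ r}.ncard

/-- The number of elements of length within `c` of `r`. -/
noncomputable def _root_.annulusCard (d : Γ → Γ → ℝ) (c r : ℝ) : ℕ :=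
  {g | r - c ≤ d 1 g ∧ d 1 g ≤ r + c}.ncard

lemma finite_annulus (h : IsRoughGeodesicHyperbolic d δ c) (r : ℝ) :
    {g | r - c ≤ d 1 g ∧ d 1 g ≤ r + c}.Finite :=
  (h.proper (r + c)).subset fun _ hg => hg.2

lemma annulusCard_le_ballCard (h : IsRoughGeodesicHyperbolic d δ c) (r : ℝ) :
    annulusCard d c r ≤ ballCard d (r + c) :=
  ncard_le_ncard (fun _ hg => hg.2) (h.proper _)

lemma ballCard_mono (h : IsRoughGeodesicHyperbolic d δ c) : Monotone (ballCard d) :=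
  fun _ s hrs => ncard_le_ncard (fun _ hg => le_trans hg hrs) (h.proper s)

lemma one_le_ballCard (h : IsRoughGeodesicHyperbolic d δ c) {r : ℝ} (hr : 0 ≤ r) :
    1 ≤ ballCard d r := by
  rw [Nat.one_le_iff_ne_zero, ← Nat.pos_iff_ne_zero, ballCard, ncard_pos (h.proper r)]
  exact ⟨1, by simpa [h.self] using hr⟩

lemma ballCard_add_le (h : IsRoughGeodesicHyperbolic d δ c) {r s : ℝ} (hr : 0 ≤ r) (hs : 0 ≤ s) :
    ballCard d (r + s) ≤ ballCard d (r + c) * ballCard d (s + c) := by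
  have hc := h.one_le
  have hsplit (x : Γ) (hx : d 1 x ≤ r + s) : ∃ u, d 1 u ≤ r + c ∧ d u x ≤ s + c := by
    obtain ⟨u, -, h2, -, h4⟩ := h.rough 1 x (min r (d 1 x)) (le_min hr (h.nonneg _ _))
      (min_le_right _ _)
    refine ⟨u, h2.trans (by linarith [min_le_left r (d 1 x)]), h4.trans ?_⟩
    rcases min_cases r (d 1 x) with h5 | h5 <;> linarith
  choose! p hp1 hp2 using hsplit
  unfold ballCard
  rw [← ncard_prod]
  refine ncard_le_ncard_of_injOn (fun x => (p x, (p x)⁻¹ * x)) ?_ ?_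
    ((h.proper _).prod (h.proper _))
  · intro x hx
    refine ⟨hp1 x hx, ?_⟩
    simpa [h.dist_one_mul] using hp2 x hx
  · intro x _ y _ hxy
    simp only [Prod.mk.injEq] at hxy
    obtain ⟨h1, h2⟩ := hxy
    rw [h1] at h2
    exact mul_left_cancel h2

/-- Supermultiplicativity of annuli, up to a fixed shift. -/
lemma exists_annulusCard_mul_le (h : IsRoughGeodesicHyperbolic d δ c) [Infinite Γ]
    (hnonelem : ¬ ∃ H : Subgroup Γ, H.FiniteIndex ∧ IsCyclic H) :
    ∃ D K : ℕ, ∀ n m : ℝ, 0 ≤ n → 0 ≤ m →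
      annulusCard d c (n + D) * annulusCard d c (m + D) ≤ K * annulusCard d c (n + m + D) := by
  obtain ⟨C, N, hC, hN, hext⟩ := h.exists_extension hnonelem 1
  have hc := h.one_le
  have hδ := h.delta_nonneg
  obtain ⟨D, hD⟩ := exists_nat_ge (2 * c + N + 2 * C)
  set R := 3 * c + N + D
  set Q := 4 * c + 2 * N + 2 * C + 2 * δ
  refine ⟨D, ballCard d R * (ballCard d N * ballCard d Q), fun n m hn hm => ?_⟩
  choose! f hf hfa using fun (a : Γ) (x : Γ) => hext {a⁻¹} (by simp) x
  choose! p hp1 hp2 hp3 hp4 using h.rough 1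
  set z : Γ × Γ → Γ := fun q => q.1 * (f q.1 q.2 * q.2) with hz
  unfold annulusCard ballCard
  rw [← ncard_prod, ← ncard_prod, ← ncard_prod, ← ncard_prod]
  refine ncard_le_ncard_of_injOn (fun q => (((p (z q) (n + m + D))⁻¹ * z q,
      (f q.1 q.2, (p (z q) (n + D))⁻¹ * q.1)), p (z q) (n + m + D))) ?_ ?_
    (((h.proper _).prod ((h.proper _).prod (h.proper _))).prod (h.finite_annulus _))
  · rintro ⟨g, y⟩ ⟨⟨hg1, hg2⟩, hy1, hy2⟩
    dsimp only at hy1 hy2 hg1 hg2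
    have hfN := hf g y
    have hgp := hfa g y g⁻¹ (by simp)
    have e1 := h.dist_one_mul g (f g y * y)
    have e2 := h.dist_one_inv g
    have e3 := h.dist_one_mul_le (f g y) y
    have e4 := h.le_dist_one_mul (f g y) y
    have e5 := h.dist_one_mul_le g (f g y * y)
    unfold gromovProd at hgp
    set x := z (g, y) with hx
    have hxe : x = g * (f g y * y) := rfl
    have e6 := h.inv g 1 (f g y * y)
    rw [mul_one, ← hxe] at e6
    rw [← hxe] at e1 e5
    have hT1 : n + m + D ≤ d 1 x := by linarith
    have hT2 : n + D ≤ d 1 x := by linarith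
    have u1 := hp1 x (n + m + D) (by positivity) hT1
    have u2 := hp2 x (n + m + D) (by positivity) hT1
    have u4 := hp4 x (n + m + D) (by positivity) hT1
    have v1 := hp1 x (n + D) (by positivity) hT2
    have v2 := hp2 x (n + D) (by positivity) hT2
    have v4 := hp4 x (n + D) (by positivity) hT2
    refine ⟨⟨?_, hfN, ?_⟩, u1, u2⟩
    · simp only [mem_ofPred_eq, h.dist_one_mul, inv_inv]
      linarith
    · simp only [mem_ofPred_eq, h.dist_one_mul, inv_inv]
      have s1 := h.symm (p x (n + D)) 1
      have s2 := h.symm g 1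
      have s3 := h.symm x 1
      rcases h.four_point (p x (n + D)) g x 1 with h9 | h9
      · linarith
      · linarith
  · rintro ⟨g, y⟩ _ ⟨g', y'⟩ _ hq
    simp only [Prod.mk.injEq] at hq
    obtain ⟨⟨q2, q3, q4⟩, q1⟩ := hq
    rw [q1] at q2
    have q5 := mul_left_cancel q2
    rw [q5] at q4
    have q6 := mul_left_cancel q4
    simp only [hz] at q5
    rw [q3, q6] at q5
    rw [q6, mul_left_cancel (mul_left_cancel q5)]

lemma exists_le_annulusCard (h : IsRoughGeodesicHyperbolic d δ c) [Infinite Γ]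
    (hnonelem : ¬ ∃ H : Subgroup Γ, H.FiniteIndex ∧ IsCyclic H) (k : ℕ) :
    ∃ T₀ : ℝ, ∀ T, T₀ ≤ T → k ≤ annulusCard d c T := by
  obtain ⟨C, N, hC, hN, hext⟩ := h.exists_extension hnonelem k
  have hc := h.one_le
  have hδ := h.delta_nonneg
  refine ⟨C + δ + c + 1, fun T hT => ?_⟩
  obtain ⟨y, hy⟩ := h.exists_dist_gt (T + N + C + 1)
  have hA : ∀ j ≤ k, ∃ A : Finset Γ, A.card = j ∧ (∀ a ∈ A, T + C + 1 ≤ d 1 a) ∧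
      ∀ a ∈ A, ∀ a' ∈ A, a ≠ a' → gromovProd d a a' ≤ C := by
    classical
    intro j
    induction j with
    | zero => exact fun _ => ⟨∅, by simp⟩
    | succ j ih =>
      intro hj
      obtain ⟨A, hcard, hlen, hprod⟩ := ih (by omega)
      obtain ⟨f, hf, hfA⟩ := hext A (by omega) y
      have hlong : T + C + 1 ≤ d 1 (f * y) := by linarith [h.le_dist_one_mul f y]
      refine ⟨insert (f * y) A, ?_, ?_, ?_⟩
      · rw [Finset.card_insert_of_notMem, hcard]
        intro hmem
        have := hfA _ hmem
        simp only [gromovProd, h.self] at this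
        linarith
      · simpa [hlong] using hlen
      · intro a ha a' ha' hne
        rw [Finset.mem_insert] at ha ha'
        rcases ha with rfl | ha <;> rcases ha' with rfl | ha'
        · exact absurd rfl hne
        · rw [h.gromovProd_comm]; exact hfA _ ha'
        · exact hfA _ ha
        · exact hprod a ha a' ha' hne
  obtain ⟨A, hcard, hlen, hprod⟩ := hA k le_rfl
  choose! p hp1 hp2 hp3 hp4 using h.rough 1
  have hT0 : 0 ≤ T := by linarith
  rw [← hcard, ← ncard_coe_finset]
  refine ncard_le_ncard_of_injOn (fun a => p a T) ?_ ?_ (h.finite_annulus T)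
  · intro a ha
    have := hlen a ha
    exact ⟨hp1 a T hT0 (by linarith), hp2 a T hT0 (by linarith)⟩
  · intro a ha a' ha' heq
    by_contra hne
    have h1 := hlen a ha
    have h2 := hlen a' ha'
    have h3 := hprod a ha a' ha' hne
    have h4 := h.gromovProd_ge a a' (p a T)
    dsimp only at heq
    have h5 : T - c ≤ gromovProd d a (p a T) := by
      rw [h.gromovProd_comm]
      unfold gromovProd
      linarith [hp1 a T hT0 (by linarith), hp4 a T hT0 (by linarith)]
    have h6 : T - c ≤ gromovProd d (p a T) a' := by
      rw [heq]
      unfold gromovProd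
      linarith [hp1 a' T hT0 (by linarith), hp4 a' T hT0 (by linarith)]
    linarith [le_min h5 h6]

lemma ballCard_le_sum_annulusCard (h : IsRoughGeodesicHyperbolic d δ c) (D n : ℕ) :
    ballCard d (n + D) ≤ ballCard d D + ∑ i ∈ Finset.range (n + 1), annulusCard d c (i + D) := by
  induction n with
  | zero => simp
  | succ n ih =>
    rw [Finset.sum_range_succ, ← add_assoc]
    refine le_trans ?_ (Nat.add_le_add_right ih _)
    refine le_trans (ncard_le_ncard ?_ ((h.proper _).union (h.finite_annulus _)))
      (ncard_union_le _ _)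
    intro g hg
    have hc := h.one_le
    rw [mem_ofPred_eq] at hg
    by_cases hgn : d 1 g ≤ n + D
    · exact Or.inl hgn
    · right
      push_cast at hg ⊢
      constructor <;> linarith

/-- The exponential growth rate exists and bounds balls from below and annuli from above. -/
theorem exists_growth (h : IsRoughGeodesicHyperbolic d δ c) [Infinite Γ]
    (hnonelem : ¬ ∃ H : Subgroup Γ, H.FiniteIndex ∧ IsCyclic H) :
    ∃ v K : ℝ, ∃ D : ℕ, 0 < v ∧ 0 < K ∧
      (∀ n : ℕ, Real.exp (v * n) ≤ ballCard d (n + 2 * c)) ∧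
      ∀ n : ℕ, (annulusCard d c (n + D) : ℝ) ≤ K * Real.exp (v * n) := by
  have hc := h.one_le
  obtain ⟨D, K₀, hDK⟩ := h.exists_annulusCard_mul_le hnonelem
  set K := K₀ + 1
  have hK : (0 : ℝ) < (K : ℕ) := by positivity
  set u : ℕ → ℝ := fun n => Real.log (ballCard d (n + 2 * c)) with hu
  have hone (n : ℕ) : (1 : ℝ) ≤ ballCard d (n + 2 * c) := by
    exact_mod_cast h.one_le_ballCard (r := n + 2 * c) (by positivity)
  have hsub : Subadditive u := by
    intro m n
    have h1 := h.ballCard_add_le (r := m + c) (s := n + c) (by positivity) (by positivity)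
    rw [show (m : ℝ) + c + (n + c) = ((m + n : ℕ) : ℝ) + 2 * c by push_cast; ring,
      show (m : ℝ) + c + c = m + 2 * c by ring, show (n : ℝ) + c + c = n + 2 * c by ring] at h1
    simp only [hu]
    rw [← Real.log_mul (by linarith [hone m]) (by linarith [hone n])]
    exact Real.log_le_log (by linarith [hone (m + n)]) (by exact_mod_cast h1)
  have hu0 (n : ℕ) : 0 ≤ u n := Real.log_nonneg (hone n)
  have hbdd : BddBelow (range fun n => u n / n) := by
    refine ⟨0, ?_⟩
    rintro _ ⟨n, rfl⟩
    exact div_nonneg (hu0 n) n.cast_nonneg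
  set v := hsub.lim
  have hlow (n : ℕ) : Real.exp (v * n) ≤ ballCard d (n + 2 * c) := by
    rcases Nat.eq_zero_or_pos n with rfl | hn
    · simpa using hone 0
    · rw [← Real.le_log_iff_exp_le (by linarith [hone n]), ← le_div_iff₀ (by exact_mod_cast hn)]
      exact hsub.lim_le_div hbdd hn.ne'
  set s : ℕ → ℝ := fun n => annulusCard d c (n + D) with hs
  have hpow (n k : ℕ) : s n ^ (k + 1) ≤ (K : ℝ) ^ k * s ((k + 1) * n) := by
    induction k with
    | zero => simp
    | succ k ih =>
      have h1 := hDK (((k + 1) * n : ℕ) : ℝ) n (by positivity) (by positivity)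
      rw [show (((k + 1) * n : ℕ) : ℝ) + n + D = (((k + 1 + 1) * n : ℕ) : ℝ) + D by
        push_cast; ring] at h1
      have h2 : s ((k + 1) * n) * s n ≤ K₀ * s ((k + 1 + 1) * n) := by
        simp only [hs]; exact_mod_cast h1
      have h3 : (K₀ : ℝ) ≤ (K : ℕ) := by simp [K]
      calc s n ^ (k + 1 + 1) = s n ^ (k + 1) * s n := pow_succ _ _
        _ ≤ (K : ℝ) ^ k * s ((k + 1) * n) * s n := by gcongr
        _ = (K : ℝ) ^ k * (s ((k + 1) * n) * s n) := by ring
        _ ≤ (K : ℝ) ^ k * (K * s ((k + 1 + 1) * n)) :=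
          mul_le_mul_of_nonneg_left
            (h2.trans (mul_le_mul_of_nonneg_right h3 (Nat.cast_nonneg _))) (by positivity)
        _ = _ := by ring
  obtain ⟨E, hE⟩ := exists_nat_ge (D + c)
  have hsu (n : ℕ) : s n ≤ Real.exp (u n + u E) := by
    refine le_trans ?_ (Real.exp_le_exp.2 (hsub n E))
    simp only [hu]
    rw [Real.exp_log (by linarith [hone (n + E)])]
    have h1 := (h.annulusCard_le_ballCard (n + D)).trans
      (h.ballCard_mono (show (n : ℝ) + D + c ≤ ((n + E : ℕ) : ℝ) + 2 * c by push_cast; linarith))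
    exact Nat.cast_le.2 h1
  have hupp (n : ℕ) (hn : 0 < n) : s n ≤ K * Real.exp (v * n) := by
    rcases eq_or_lt_of_le (show 0 ≤ s n from Nat.cast_nonneg _) with h0 | h0
    · rw [← h0]; positivity
    have hkey (k : ℕ) : Real.log (s n) - Real.log K ≤
        u ((k + 1) * n) / ((k + 1) * n : ℕ) * n + u E / ((k + 1 : ℕ) : ℝ) := by
      have h1 : s n ^ (k + 1) ≤ (K : ℝ) ^ (k + 1) * Real.exp (u ((k + 1) * n) + u E) := by
        refine (hpow n k).trans ?_
        gcongr
        · simp [K]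
        · omega
        · exact hsu _
      have h2 := Real.log_le_log (by positivity) h1
      rw [Real.log_pow, Real.log_mul (by positivity) (by positivity), Real.log_pow,
        Real.log_exp] at h2
      have hn' : (0 : ℝ) < n := by exact_mod_cast hn
      rw [show u ((k + 1) * n) / ((k + 1) * n : ℕ) * n + u E / ((k + 1 : ℕ) : ℝ) =
        (u ((k + 1) * n) + u E) / ((k + 1 : ℕ) : ℝ) by push_cast; field_simp,
        le_div_iff₀ (by positivity)]
      linarith
    have hlim : Tendsto (fun k : ℕ => u ((k + 1) * n) / ((k + 1) * n : ℕ) * n +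
        u E / ((k + 1 : ℕ) : ℝ)) atTop (nhds (v * n + 0)) := by
      have t1 : Tendsto (fun k : ℕ => k + 1) atTop atTop := tendsto_add_atTop_nat 1
      have t2 : Tendsto (fun k : ℕ => (k + 1) * n) atTop atTop := t1.atTop_mul_const' hn
      exact (((hsub.tendsto_lim hbdd).comp t2).mul_const _).add
        (tendsto_const_nhds.div_atTop (tendsto_natCast_atTop_atTop.comp t1))
    have h3 := ge_of_tendsto' hlim hkey
    rw [← Real.exp_log h0, ← Real.exp_log hK, ← Real.exp_add]
    exact Real.exp_le_exp.2 (by linarith)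
  have hv : 0 < v := by
    obtain ⟨T₀, hT⟩ := h.exists_le_annulusCard hnonelem (K + 1)
    obtain ⟨n, hn⟩ := exists_nat_ge T₀
    have h1 : ((K + 1 : ℕ) : ℝ) ≤ s (n + 1) := by
      exact Nat.cast_le.2
        (hT (((n + 1 : ℕ) : ℝ) + D) (by push_cast; linarith [D.cast_nonneg (α := ℝ)]))
    have h2 := hupp (n + 1) n.succ_pos
    by_contra hneg
    have h3 : Real.exp (v * (n + 1 : ℕ)) ≤ 1 :=
      Real.exp_le_one_iff.2 (mul_nonpos_of_nonpos_of_nonneg (not_lt.1 hneg) (by positivity))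
    have h4 := mul_le_mul_of_nonneg_left h3 hK.le
    push_cast at h1 h2 h3 h4
    linarith
  refine ⟨v, K + s 0, D, hv, by positivity, hlow, fun n => ?_⟩
  have hs0 : 0 ≤ s 0 := Nat.cast_nonneg _
  rcases Nat.eq_zero_or_pos n with rfl | hn
  · change s 0 ≤ _
    simp
  · refine (hupp n hn).trans ?_
    gcongr
    linarith

theorem exists_pure_exponential_growth (h : IsRoughGeodesicHyperbolic d δ c) [Infinite Γ]
    (hnonelem : ¬ ∃ H : Subgroup Γ, H.FiniteIndex ∧ IsCyclic H) :
    ∃ v C : ℝ, 0 < v ∧ 0 < C ∧ ∀ r, 0 < r →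
      C⁻¹ * Real.exp (v * r) ≤ ballCard d r ∧ (ballCard d r : ℝ) ≤ C * Real.exp (v * r) := by
  have hc := h.one_le
  obtain ⟨v, K, D, hv, hK, hlow, hupp⟩ := h.exists_growth hnonelem
  set A := Real.exp (v * (2 * c + 1)) with hA
  set B := ballCard d D + K * (Real.exp (2 * v) / (Real.exp v - 1)) with hB
  have hev : 0 < Real.exp v - 1 := by linarith [Real.add_one_lt_exp hv.ne']
  have hB0 : 0 ≤ B := by positivity
  refine ⟨v, A + B, hv, by positivity, fun r hr => ⟨?_, ?_⟩⟩
  · have h1 : (A + B)⁻¹ ≤ A⁻¹ := by gcongr; linarith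
    refine (mul_le_mul_of_nonneg_right h1 (Real.exp_nonneg _)).trans ?_
    rw [hA, ← Real.exp_neg, ← Real.exp_add]
    rcases le_total (2 * c) r with h2 | h2
    · refine le_trans (Real.exp_le_exp.2 ?_) ((hlow ⌊r - 2 * c⌋₊).trans ?_)
      · have := Nat.lt_floor_add_one (r - 2 * c)
        have := mul_le_mul_of_nonneg_left this.le hv.le
        linarith
      · have := Nat.floor_le (show 0 ≤ r - 2 * c by linarith)
        exact_mod_cast h.ballCard_mono (by linarith)
    · refine le_trans (Real.exp_le_one_iff.2 ?_) (by exact_mod_cast h.one_le_ballCard hr.le)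
      nlinarith
  · set n := ⌊r⌋₊ + 1 with hn
    have hrn : r ≤ n := by simpa [hn] using (Nat.lt_floor_add_one r).le
    have hnr : (n : ℝ) ≤ r + 1 := by
      rw [hn]; push_cast; linarith [Nat.floor_le hr.le]
    have h1 : (ballCard d r : ℝ) ≤
        ballCard d D + ∑ i ∈ Finset.range (n + 1), (annulusCard d c (i + D) : ℝ) := by
      exact_mod_cast (h.ballCard_mono (by linarith [D.cast_nonneg (α := ℝ)])).trans
        (h.ballCard_le_sum_annulusCard D n)
    have h2 : ∑ i ∈ Finset.range (n + 1), (annulusCard d c (i + D) : ℝ) ≤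
        K * (Real.exp (2 * v) / (Real.exp v - 1)) * Real.exp (v * r) := by
      calc ∑ i ∈ Finset.range (n + 1), (annulusCard d c (i + D) : ℝ)
          ≤ ∑ i ∈ Finset.range (n + 1), K * Real.exp v ^ i :=
            Finset.sum_le_sum fun i _ => by
              rw [← Real.exp_nat_mul, mul_comm (i : ℝ)]; exact hupp i
        _ = K * ((Real.exp v ^ (n + 1) - 1) / (Real.exp v - 1)) := by
            rw [← Finset.mul_sum, geom_sum_eq (by linarith)]
        _ ≤ K * (Real.exp (2 * v + v * r) / (Real.exp v - 1)) := by
            gcongr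
            rw [← Real.exp_nat_mul]
            have : Real.exp (((n + 1 : ℕ) : ℝ) * v) ≤ Real.exp (2 * v + v * r) := by
              refine Real.exp_le_exp.2 ?_
              push_cast
              nlinarith
            linarith
        _ = _ := by rw [Real.exp_add]; ring
    have h3 : (ballCard d D : ℝ) ≤ ballCard d D * Real.exp (v * r) :=
      le_mul_of_one_le_right (Nat.cast_nonneg _) (Real.one_le_exp (by positivity))
    have h4 : 0 ≤ A * Real.exp (v * r) := by positivity
    rw [hB]
    linarith

end IsRoughGeodesicHyperbolic

theorem stmt_12
    {Γ : Type} [Group Γ] [Countable Γ] (d : Γ → Γ → ℝ)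
    (hzero : ∀ x y : Γ, d x y = 0 ↔ x = y)
    (hsymm : ∀ x y : Γ, d x y = d y x)
    (htri : ∀ x y z : Γ, d x z ≤ d x y + d y z)
    (hinv : ∀ g x y : Γ, d (g * x) (g * y) = d x y)
    (hproper : ∀ R : ℝ, {g : Γ | d 1 g ≤ R}.Finite)
    (hhyp : ∃ δ : ℝ, 0 ≤ δ ∧ ∀ x y z w : Γ,
      (d x w + d y w - d x y) / 2 ≥
        min ((d x w + d z w - d x z) / 2) ((d y w + d z w - d y z) / 2) - δ)
    (hqg : ∃ c : ℝ, 0 < c ∧ ∀ x y : Γ, ∃ (s t : ℝ) (γ : ℝ → Γ), s ≤ t ∧ γ s = x ∧ γ t = y ∧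
      ∀ i ∈ Set.Icc s t, ∀ j ∈ Set.Icc s t,
        |i - j| - c ≤ d (γ i) (γ j) ∧ d (γ i) (γ j) ≤ |i - j| + c)
    (hinfinite : Infinite Γ)
    (hnonelem : ¬ ∃ H : Subgroup Γ, H.FiniteIndex ∧ IsCyclic H) :
    ∃ v C : ℝ, 0 < v ∧ 0 < C ∧ ∀ g : Γ, ∀ r : ℝ, 0 < r →
      C⁻¹ * Real.exp (v * r) ≤ (Nat.card {h : Γ // d g h ≤ r} : ℝ) ∧
      (Nat.card {h : Γ // d g h ≤ r} : ℝ) ≤ C * Real.exp (v * r) := by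
  obtain ⟨δ, hδ, hfour⟩ := hhyp
  obtain ⟨c, hc, hrough⟩ := hqg
  have h : IsRoughGeodesicHyperbolic d δ (3 * c + 1) :=
    { self := fun x => (hzero x x).2 rfl
      symm := hsymm
      tri := htri
      inv := hinv
      proper := hproper
      delta_nonneg := hδ
      one_le := by linarith
      four_point := fun x y z w => by
        have h1 := hfour x y z w
        rcases min_le_iff.1 (le_refl (min ((d x w + d z w - d x z) / 2)
          ((d y w + d z w - d y z) / 2))) with h2 | h2
        · left; linarith
        · right; linarith
      rough := fun x y T hT hTd => by
        obtain ⟨s, t, γ, hst, rfl, rfl, hγ⟩ := hrough x y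
        have hs : s ∈ Icc s t := left_mem_Icc.2 hst
        have ht : t ∈ Icc s t := right_mem_Icc.2 hst
        have hu : s + min T (t - s) ∈ Icc s t :=
          ⟨by linarith [le_min hT (sub_nonneg.2 hst)], by linarith [min_le_right T (t - s)]⟩
        have h1 := hγ s hs t ht
        have h2 := hγ s hs _ hu
        have h3 := hγ _ hu t ht
        rw [abs_sub_comm, abs_of_nonneg (sub_nonneg.2 hst)] at h1
        rw [abs_sub_comm, abs_of_nonneg (sub_nonneg.2 hu.1)] at h2
        rw [abs_sub_comm, abs_of_nonneg (sub_nonneg.2 hu.2)] at h3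
        refine ⟨γ (s + min T (t - s)), ?_⟩
        rcases min_cases T (t - s) with ⟨h4, h5⟩ | ⟨h4, h5⟩ <;> rw [h4] at h2 h3 ⊢ <;>
          refine ⟨?_, ?_, ?_, ?_⟩ <;> linarith [h1.1, h1.2, h2.1, h2.2, h3.1, h3.2] }
  obtain ⟨v, C, hv, hC, hgrowth⟩ := h.exists_pure_exponential_growth hnonelem
  refine ⟨v, C, hv, hC, fun g r hr => ?_⟩
  have hcard : Nat.card {x : Γ // d g x ≤ r} = ballCard d r := by
    refine Nat.card_congr ((Equiv.mulLeft g⁻¹).subtypeEquiv fun x => ?_)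
    rw [Equiv.coe_mulLeft, mem_ofPred_eq, h.dist_one_mul, inv_inv]
  rw [hcard]
  exact hgrowth r hr
end

section
/- Let (Γ,d) be a non-elementary uniformly quasi-geodesic hyperbolic group. Then there is a constant R > 0, depending only on (Γ,d), such that for all x, y, z ∈ Γ there exists a sequence {w_i} ⊂ Γ with lim_{i,j→∞} (w_i|w_j)_e = ∞ (a Gromov sequence), limsup_{i→∞} (w_i|x)_z ≤ R, and limsup_{i→∞} (w_i|y)_z ≤ R. (Equivalently: there exists a boundary point η of Γ with Gromov products (η|x)_z ≤ R and (η|y)_z ≤ R.) -/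
open MeasureTheory Filter Set

/-- The Gromov product `(x|y)_w`. -/
noncomputable def gromovProduct {Γ : Type*} (d : Γ → Γ → ℝ) (x y w : Γ) : ℝ :=
  (d x w + d y w - d x y) / 2

/-- A proper left-invariant metric on a group which is `δ`-hyperbolic, and in which any two points
`u`, `v` are joined by a coarse geodesic, up to an additive error `k`. -/
structure IsHyperbolicGroupMetric {Γ : Type*} [Group Γ] (d : Γ → Γ → ℝ) (δ k : ℝ) : Prop where
  delta_nonneg : 0 ≤ δ
  error_nonneg : 0 ≤ k
  dist_self : ∀ x, d x x = 0
  symm : ∀ x y, d x y = d y x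
  tri : ∀ x y z, d x z ≤ d x y + d y z
  inv : ∀ g x y, d (g * x) (g * y) = d x y
  proper : ∀ R : ℝ, {g : Γ | d 1 g ≤ R}.Finite
  hyp : ∀ x y z w, gromovProduct d x z w - δ ≤ gromovProduct d x y w ∨
    gromovProduct d y z w - δ ≤ gromovProduct d x y w
  interp : ∀ u v r, 0 ≤ r → r ≤ d u v →
    ∃ q, |d u q - r| ≤ k ∧ d u q + d q v ≤ d u v + k

namespace IsHyperbolicGroupMetric

variable {Γ : Type*} [Group Γ] {d : Γ → Γ → ℝ} {δ k : ℝ}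

lemma nonneg (h : IsHyperbolicGroupMetric d δ k) (x y : Γ) : 0 ≤ d x y := by
  have h1 := h.tri x y x
  rw [h.dist_self, h.symm y x] at h1
  linarith

lemma gromovProduct_mul_left (h : IsHyperbolicGroupMetric d δ k) (g x y w : Γ) :
    gromovProduct d (g * x) (g * y) (g * w) = gromovProduct d x y w := by
  simp only [gromovProduct, h.inv]

/-- If `p` is an almost nearest point to `x` on the coarse geodesic from `u` to `v`, then the
Gromov product of `x` and `u` based at `p` is bounded. -/
lemma gromovProduct_le_of_nearest (h : IsHyperbolicGroupMetric d δ k) {u v p x : Γ} {E : ℝ}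
    (hp : d u p + d p v ≤ d u v + k)
    (hx : ∀ q, d u q + d q v ≤ d u v + k → d x p ≤ d x q + E) :
    gromovProduct d x u p ≤ E + 7 * k + 4 * δ := by
  have hT0 : 0 ≤ gromovProduct d x u p := by
    have := h.tri x p u
    rw [h.symm p u] at this
    simp only [gromovProduct]
    linarith
  have hT1 : gromovProduct d x u p ≤ d u p := by
    have := h.tri x u p
    simp only [gromovProduct]
    linarith
  have hk := h.error_nonneg
  have hδ := h.delta_nonneg
  have hpv := h.nonneg p v
  obtain ⟨q, hq1, hq2⟩ := h.interp u v (min (d u p - gromovProduct d x u p) (d u v))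
    (le_min (by linarith) (h.nonneg u v)) (min_le_right _ _)
  rw [abs_le] at hq1
  have hr1 : min (d u p - gromovProduct d x u p) (d u v) ≤ d u p - gromovProduct d x u p :=
    min_le_left _ _
  have hr2 : d u p - gromovProduct d x u p - k ≤
      min (d u p - gromovProduct d x u p) (d u v) := le_min (by linarith) (by linarith)
  have hxq := hx q hq2
  have hpq : d p q ≤ d u p - d u q + 3 * k + 2 * δ := by
    have h1 := h.hyp p q v u
    have s1 := h.symm p u
    have s2 := h.symm q u
    have s3 := h.symm v u
    simp only [gromovProduct] at h1
    rcases h1 with h1 | h1 <;> linarith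
  have h2 := h.hyp x q u p
  have s4 := h.symm q p
  have s5 := h.symm q u
  rcases h2 with h2 | h2 <;> simp only [gromovProduct] at * <;> linarith

/-- Moving the base point from `o` to `p` when `p` lies opposite to `a` as seen from `o`. -/
lemma gromovProduct_le_of_opposite (h : IsHyperbolicGroupMetric d δ k) {o p a y : Γ} {K C C' : ℝ}
    (hpa : gromovProduct d p a o ≤ K) (hy : gromovProduct d y o p ≤ C)
    (hya : d o p ≤ C + K + δ → gromovProduct d y a o ≤ C') (hK : 0 ≤ C' + K) :
    gromovProduct d y a p ≤ C + C' + K + δ + δ := by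
  have hδ := h.delta_nonneg
  have h1 := h.hyp y o a p
  have s1 := h.symm o p
  have s2 := h.symm a o
  have s3 := h.symm a p
  have t2 := h.tri a o p
  rcases h1 with h1 | h1
  · linarith
  · have hop : d o p ≤ C + K + δ := by simp only [gromovProduct] at *; linarith
    have := hya hop
    simp only [gromovProduct] at *
    linarith

/-- A point `x` whose nearest point on a long coarse geodesic through `o` is `p` forms
a tripod centred at `p` with the two ends of this geodesic. -/
lemma exists_tripod_of_nearest (h : IsHyperbolicGroupMetric d δ k) {o a b p x : Γ} {K : ℝ}
    (hK : 0 ≤ K) (hab : gromovProduct d a b o ≤ K) (hp : d o p + d p b ≤ d o b + k)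
    (hxb : ∀ q, d o q + d q b ≤ d o b + k → d x p ≤ d x q)
    (hxa : ∀ q, d o q + d q a ≤ d o a + k → d x p ≤ d x q) :
    d o a + d o p - 2 * (K + k + δ) ≤ d p a ∧
    gromovProduct d x b p ≤ 4 * K + 30 * k + 20 * δ ∧
    gromovProduct d x a p ≤ 4 * K + 30 * k + 20 * δ ∧
    gromovProduct d a b p ≤ 4 * K + 30 * k + 20 * δ := by
  have hk := h.error_nonneg
  have hδ := h.delta_nonneg
  have hpa : gromovProduct d p a o ≤ K + k + δ := by
    have h1 := h.hyp a b p o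
    have s1 := h.symm o p
    have s2 := h.symm p a
    have s3 := h.symm b o
    have s4 := h.symm b p
    have t1 := h.tri a p o
    simp only [gromovProduct] at *
    rcases h1 with h1 | h1 <;> linarith
  have hxo : gromovProduct d x o p ≤ 7 * k + 4 * δ := by
    have := h.gromovProduct_le_of_nearest (E := 0) hp (fun q hq => by simpa using hxb q hq)
    linarith
  have hxb' : gromovProduct d x b p ≤ 7 * k + 4 * δ := by
    have := h.gromovProduct_le_of_nearest (u := b) (v := o) (p := p) (x := x) (E := 0)
      (by rw [h.symm b p, h.symm p o, h.symm b o]; linarith)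
      (fun q hq => by
        rw [h.symm b q, h.symm q o, h.symm b o] at hq
        have := hxb q (by linarith)
        linarith)
    linarith
  refine ⟨?_, by linarith, ?_, ?_⟩
  · have s1 := h.symm o p
    have s2 := h.symm a o
    simp only [gromovProduct] at hpa
    linarith
  · have := h.gromovProduct_le_of_opposite (C' := 2 * (7 * k + 4 * δ) + (K + k + δ) + δ)
      hpa hxo (fun hop => ?_) (by linarith)
    · linarith
    · have h2 := h.gromovProduct_le_of_nearest (u := a) (v := o) (p := o) (x := x) (E := d o p)
        (by rw [h.dist_self]; linarith)
        (fun q hq => by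
          rw [h.symm a q, h.symm q o, h.symm a o] at hq
          have h3 := hxa q (by linarith)
          have h4 := h.tri x p o
          rw [h.symm p o] at h4
          linarith)
      linarith
  · have hbo : gromovProduct d b o p ≤ k := by
      have s1 := h.symm b p
      have s2 := h.symm b o
      simp only [gromovProduct]
      linarith
    have hba : gromovProduct d b a = gromovProduct d a b := by
      funext w
      simp only [gromovProduct, h.symm a b]
      ring
    have := h.gromovProduct_le_of_opposite (y := b) (C' := K)
      hpa hbo (fun _ => by rw [hba]; exact hab) (by linarith)
    rw [hba] at this
    linarith

lemma exists_dist_ge [Infinite Γ] (h : IsHyperbolicGroupMetric d δ k) (M : ℝ) :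
    ∃ w, M ≤ d 1 w := by
  by_contra! hc
  exact Set.infinite_univ ((h.proper M).subset fun w _ => (hc w).le)

/-- There are arbitrarily long elements `g` such that `g⁻¹`, `1`, `g` is almost geodesic. -/
lemma exists_opposite_inv [Infinite Γ] (h : IsHyperbolicGroupMetric d δ k) (M : ℝ) :
    ∃ g : Γ, M ≤ d 1 g ∧ gromovProduct d g⁻¹ g 1 ≤ k + 3 * δ := by
  have hk := h.error_nonneg
  have hδ := h.delta_nonneg
  obtain ⟨w, hw⟩ := h.exists_dist_ge (2 * (|M| + 3 * k + 10 * δ + 1))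
  have hM := le_abs_self M
  have hM0 := abs_nonneg M
  obtain ⟨q, hq1, hq2⟩ := h.interp 1 w (d 1 w / 2) (by linarith) (by linarith)
  rw [abs_le] at hq1
  have hlen (g : Γ) : d g⁻¹ 1 = d 1 g := by simpa using (h.inv g g⁻¹ 1).symm
  obtain ⟨u, v, hu, hv, huv⟩ : ∃ u v : Γ, |M| + 2 * k + 10 * δ + 1 ≤ d 1 u ∧
      |M| + 2 * k + 10 * δ + 1 ≤ d 1 v ∧ gromovProduct d u v 1 ≤ k := by
    have h1 : d q⁻¹ 1 = d 1 q := hlen q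
    have h2 : d 1 (q⁻¹ * w) = d q w := by simpa using (h.inv q 1 (q⁻¹ * w)).symm
    have h3 : d q⁻¹ (q⁻¹ * w) = d 1 w := by simpa using h.inv q⁻¹ 1 w
    have t := h.tri 1 q w
    refine ⟨q⁻¹, q⁻¹ * w, ?_, ?_, ?_⟩
    · rw [h.symm, h1]; linarith
    · rw [h2]; linarith
    · rw [gromovProduct, h1, h3, h.symm _ 1, h2]; linarith
  by_cases hu' : gromovProduct d u⁻¹ u 1 ≤ k + 3 * δ
  · exact ⟨u, by linarith, hu'⟩
  by_cases hv' : gromovProduct d v⁻¹ v 1 ≤ k + 3 * δ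
  · exact ⟨v, by linarith, hv'⟩
  have e1 : d u⁻¹ v = d 1 (u * v) := by simpa using (h.inv u u⁻¹ v).symm
  have e2 : d (u * v) u = d 1 v := by
    have := h.inv u v 1
    rw [mul_one] at this
    rw [this, h.symm]
  have e3 : d (u * v)⁻¹ v⁻¹ = d 1 u := by
    have := h.inv v⁻¹ u⁻¹ 1
    rw [mul_one] at this
    rw [mul_inv_rev, this, hlen]
  have e4 := hlen (u * v)
  have e5 := hlen u
  have e6 := hlen v
  have s1 := h.symm u 1
  have s2 := h.symm v 1
  have s3 := h.symm (u * v) 1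
  have s4 := h.symm u⁻¹ u
  have s5 := h.symm v⁻¹ v
  have s6 := h.symm u⁻¹ v
  have s7 := h.symm (u * v) u
  have H1 := h.hyp u v u⁻¹ 1
  have H2 := h.hyp u v (u * v)⁻¹ 1
  have H3 := h.hyp u (u * v)⁻¹ (u * v) 1
  have H4 := h.hyp v (u * v)⁻¹ v⁻¹ 1
  have hlow : d u⁻¹ v = d u⁻¹ 1 + d v 1 - 2 * gromovProduct d u⁻¹ v 1 := by
    simp only [gromovProduct]; ring
  have hprod : gromovProduct d u⁻¹ v 1 ≤ k + δ := by
    simp only [gromovProduct] at *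
    rcases H1 with H1 | H1 <;> linarith
  refine ⟨u * v, by linarith, ?_⟩
  simp only [gromovProduct] at *
  rcases H2 with H2 | H2
  · rcases H3 with H3 | H3 <;> linarith
  · rcases H4 with H4 | H4 <;> linarith

lemma finiteIndex_zpowers (h : IsHyperbolicGroupMetric d δ k) {g : Γ} {N : ℝ}
    (hN : ∀ x, ∃ n : ℤ, d x (g ^ n) ≤ N) : (Subgroup.zpowers g).FiniteIndex := by
  have hfin : Finite {b : Γ | d 1 b ≤ N} := (h.proper N).to_subtype
  have : Finite (Γ ⧸ Subgroup.zpowers g) := by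
    refine Finite.of_surjective
      (fun b : {b : Γ | d 1 b ≤ N} => (QuotientGroup.mk b.1 : Γ ⧸ Subgroup.zpowers g)) ?_
    intro y
    obtain ⟨x, rfl⟩ := QuotientGroup.mk_surjective y
    obtain ⟨n, hn⟩ := hN x⁻¹
    refine ⟨⟨x * g ^ n, ?_⟩, ?_⟩
    · have := h.inv x x⁻¹ (g ^ n)
      rw [mul_inv_cancel] at this
      exact this.trans_le hn
    · exact QuotientGroup.eq.2 ⟨-n, by simp⟩
  exact Subgroup.finiteIndex_of_finite_quotient

/-- Three points at distance at least `N` from the identity with pairwise Gromov products at most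
`K`. -/
def _root_.IsTripod (d : Γ → Γ → ℝ) (K N : ℝ) (a : Fin 3 → Γ) : Prop :=
  (∀ i, N ≤ d 1 (a i)) ∧ ∀ i j, i ≠ j → gromovProduct d (a i) (a j) 1 ≤ K

lemma exists_isTripod (h : IsHyperbolicGroupMetric d δ k) {p a b x : Γ} {K N : ℝ}
    (ha : N ≤ d p a) (hb : N ≤ d p b) (hx : N ≤ d p x) (hab : gromovProduct d a b p ≤ K)
    (hxa : gromovProduct d x a p ≤ K) (hxb : gromovProduct d x b p ≤ K) :
    ∃ t, IsTripod d K N t := by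
  have comm (u v : Γ) : gromovProduct d u v p = gromovProduct d v u p := by
    simp only [gromovProduct, h.symm u v]
    ring
  let t : Fin 3 → Γ := ![a, b, x]
  refine ⟨fun i => p⁻¹ * t i, fun i => ?_, fun i j hij => ?_⟩
  · have h1 : d 1 (p⁻¹ * t i) = d p (t i) := by simpa using h.inv p⁻¹ p (t i)
    rw [h1]
    fin_cases i <;> simpa [t]
  · have h1 := h.gromovProduct_mul_left p⁻¹ (t i) (t j) p
    rw [inv_mul_cancel] at h1
    rw [h1]
    fin_cases i <;> fin_cases j <;> simp [t] at hij ⊢ <;>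
      first | assumption | (rw [comm]; assumption)

/-- In a group which is not virtually cyclic there are arbitrarily large tripods. -/
lemma exists_isTripod_of_not_virtuallyCyclic [Infinite Γ] (h : IsHyperbolicGroupMetric d δ k)
    (hne : ¬ ∃ H : Subgroup Γ, H.FiniteIndex ∧ IsCyclic H) (N : ℝ) :
    ∃ t, IsTripod d (4 * (k + 3 * δ) + 30 * k + 20 * δ) N t := by
  by_contra hT
  have hk := h.error_nonneg
  have hδ := h.delta_nonneg
  have hN0 := abs_nonneg N
  have hN1 := le_abs_self N
  obtain ⟨g, hg, hgg⟩ := h.exists_opposite_inv (2 * |N| + 2 * (2 * k + 4 * δ))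
  refine hne ⟨Subgroup.zpowers g, h.finiteIndex_zpowers (N := |N| + d 1 g + k) fun x => ?_,
    inferInstance⟩
  let Q : Set Γ := {q | ∃ n : ℤ, d (g ^ n) q + d q (g ^ (n + 1)) ≤ d 1 g + k}
  have h1Q : (1 : Γ) ∈ Q := ⟨0, by simp [h.dist_self, hk]⟩
  have hball : {q | d x q ≤ d x 1}.Finite := by
    refine ((h.proper (d x 1)).image (x * ·)).subset fun q hq => ⟨x⁻¹ * q, ?_, by simp⟩
    have : d 1 (x⁻¹ * q) = d x q := by simpa using (h.inv x 1 (x⁻¹ * q)).symm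
    exact this.trans_le hq
  obtain ⟨p, ⟨hpQ, hp1⟩, hpmin⟩ := Set.exists_min_image (Q ∩ {q | d x q ≤ d x 1}) (d x)
    (hball.subset inter_subset_right) ⟨1, h1Q, le_refl (d x 1)⟩
  have hmin : ∀ q ∈ Q, d x p ≤ d x q := fun q hq => by
    by_cases hq1 : d x q ≤ d x 1
    · exact hpmin q ⟨hq, hq1⟩
    · exact hp1.trans (not_le.1 hq1).le
  obtain ⟨n, hn⟩ := hpQ
  have hstep (m : ℤ) : d (g ^ m) (g ^ (m + 1)) = d 1 g := by
    simpa [zpow_add] using h.inv (g ^ m) 1 g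
  have hopp (m : ℤ) : gromovProduct d (g ^ (m - 1)) (g ^ (m + 1)) (g ^ m) ≤ k + 3 * δ := by
    have := h.gromovProduct_mul_left (g ^ m) g⁻¹ g 1
    rw [mul_one, ← zpow_neg_one, ← zpow_add, ← zpow_add_one, ← sub_eq_add_neg, zpow_neg_one] at this
    rw [this]
    exact hgg
  have hxp : d p x < |N| := by
    by_contra! hxp
    have s1 := h.symm (g ^ (n + 1)) (g ^ n)
    have s2 := h.symm p (g ^ n)
    have s3 := h.symm p (g ^ (n + 1))
    have s4 := hstep n
    have t1 := h.tri (g ^ n) p (g ^ (n + 1))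
    have h0 := h.nonneg (g ^ n) p
    have h0' := h.nonneg p (g ^ (n + 1))
    rcases le_total (d 1 g / 2) (d p (g ^ (n + 1))) with hc | hc
    · have s5 := hstep (n - 1)
      rw [sub_add_cancel, h.symm] at s5
      obtain ⟨r1, r2, r3, r4⟩ := h.exists_tripod_of_nearest (o := g ^ n) (a := g ^ (n - 1))
        (b := g ^ (n + 1)) (p := p) (x := x) (by linarith) (hopp n) (by linarith)
        (fun q hq => hmin q ⟨n, by linarith⟩)
        (fun q hq => hmin q ⟨n - 1, by
          rw [sub_add_cancel, h.symm (g ^ (n - 1)) q, h.symm q (g ^ n)]; linarith⟩)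
      exact hT (h.exists_isTripod (by linarith) (by linarith) (by linarith) r4 r3 r2)
    · have s5 := hstep (n + 1)
      have ho := hopp (n + 1)
      rw [add_sub_cancel_right] at ho
      have ho' : gromovProduct d (g ^ (n + 1 + 1)) (g ^ n) (g ^ (n + 1)) ≤ k + 3 * δ := by
        rw [gromovProduct, h.symm (g ^ (n + 1 + 1)) (g ^ n)]
        rw [gromovProduct] at ho
        linarith
      obtain ⟨r1, r2, r3, r4⟩ := h.exists_tripod_of_nearest (o := g ^ (n + 1))
        (a := g ^ (n + 1 + 1)) (b := g ^ n) (p := p) (x := x) (by linarith) ho' (by linarith)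
        (fun q hq => hmin q ⟨n, by
          rw [h.symm (g ^ n) q, h.symm q (g ^ (n + 1))]; linarith⟩)
        (fun q hq => hmin q ⟨n + 1, by linarith⟩)
      exact hT (h.exists_isTripod (by linarith) (by linarith) (by linarith) r4 r3 r2)
  refine ⟨n, ?_⟩
  have t := h.tri x p (g ^ n)
  have s1 := h.symm x p
  have s2 := h.symm p (g ^ n)
  have h0 := h.nonneg p (g ^ (n + 1))
  linarith

/-- Along an ultrafilter, a sequence going to infinity has a limit point at infinity, represented
by a coarse geodesic ray. -/
lemma exists_ray (h : IsHyperbolicGroupMetric d δ k) {w : ℕ → Γ}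
    (hw : ∀ n : ℕ, (n : ℝ) ≤ d 1 (w n)) :
    ∃ p : ℕ → Γ, ∀ m : ℕ, d 1 (p m) ≤ m + k ∧
      ∀ᶠ n in (hyperfilter ℕ : Filter ℕ), m - 2 * k ≤ gromovProduct d (p m) (w n) 1 := by
  have key (m : ℕ) : ∃ p, d 1 p ≤ m + k ∧
      ∀ᶠ n in (hyperfilter ℕ : Filter ℕ), m - 2 * k ≤ gromovProduct d p (w n) 1 := by
    have hev : ∀ᶠ n in (hyperfilter ℕ : Filter ℕ), ∃ p ∈ {p | d 1 p ≤ m + k},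
        m - 2 * k ≤ gromovProduct d p (w n) 1 := by
      have : ∀ᶠ n in (hyperfilter ℕ : Filter ℕ), m ≤ n :=
        Nat.hyperfilter_le_atTop (eventually_ge_atTop m)
      filter_upwards [this] with n hn
      have hmn : (m : ℝ) ≤ n := by exact_mod_cast hn
      obtain ⟨q, hq1, hq2⟩ := h.interp 1 (w n) m (by positivity) (hmn.trans (hw n))
      rw [abs_le] at hq1
      refine ⟨q, by linarith, ?_⟩
      rw [gromovProduct, h.symm q 1, h.symm (w n) 1]
      linarith
    rw [Ultrafilter.eventually_exists_mem_iff (h.proper _)] at hev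
    exact hev
  choose p hp using key
  exact ⟨p, hp⟩

/-- If there are arbitrarily large tripods, there are three distinct points at infinity. -/
lemma exists_three_rays (h : IsHyperbolicGroupMetric d δ k) {K : ℝ}
    (hT : ∀ N : ℝ, ∃ t, IsTripod d K N t) :
    ∃ (p : Fin 3 → ℕ → Γ) (K' : ℝ),
      (∀ i (m n : ℕ), min (m : ℝ) n - 2 * k - δ ≤ gromovProduct d (p i m) (p i n) 1) ∧
      ∀ i j, i ≠ j → ∀ m n, gromovProduct d (p i m) (p j n) 1 ≤ K' := by
  have hk := h.error_nonneg
  have hδ := h.delta_nonneg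
  choose t ht1 ht2 using fun n : ℕ => hT n
  choose p hp1 hp2 using fun i => h.exists_ray (w := fun n => t n i) fun n => ht1 n i
  refine ⟨p, |K| + 2 * δ + 3 * k, fun i m n => ?_, fun i j hij m n => ?_⟩
  · obtain ⟨l, hl1, hl2⟩ := ((hp2 i m).and (hp2 i n)).exists
    have h1 := min_le_left (m : ℝ) n
    have h2 := min_le_right (m : ℝ) n
    rcases h.hyp (p i m) (p i n) (t l i) 1 with h3 | h3 <;> linarith
  · obtain ⟨l, hl1, hl2⟩ := ((hp2 i m).and (hp2 j n)).exists
    have hK := ht2 l i j hij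
    have habs := le_abs_self K
    have t1 := h.tri (p i m) (p j n) 1
    have t2 := h.tri (p j n) (p i m) 1
    have s0 := h.symm (p i m) (p j n)
    have s1 := h.symm (p i m) 1
    have s2 := h.symm (p j n) 1
    have s3 := h.symm (p i m) (t l i)
    have s4 := h.symm (p j n) (t l j)
    have b1 := hp1 i m
    have b2 := hp1 j n
    have H1 := h.hyp (t l i) (t l j) (p j n) 1
    have H2 := h.hyp (t l i) (p j n) (p i m) 1
    simp only [gromovProduct] at *
    rcases H1 with H1 | H1
    · rcases H2 with H2 | H2 <;> linarith
    · linarith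

end IsHyperbolicGroupMetric

theorem stmt_15
    {Γ : Type} [Group Γ] [Countable Γ] (d : Γ → Γ → ℝ)
    (hzero : ∀ x y : Γ, d x y = 0 ↔ x = y)
    (hsymm : ∀ x y : Γ, d x y = d y x)
    (htri : ∀ x y z : Γ, d x z ≤ d x y + d y z)
    (hinv : ∀ g x y : Γ, d (g * x) (g * y) = d x y)
    (hproper : ∀ R : ℝ, {g : Γ | d 1 g ≤ R}.Finite)
    (hhyp : ∃ δ : ℝ, 0 ≤ δ ∧ ∀ x y z w : Γ,
      (d x w + d y w - d x y) / 2 ≥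
        min ((d x w + d z w - d x z) / 2) ((d y w + d z w - d y z) / 2) - δ)
    (hqg : ∃ c : ℝ, 0 < c ∧ ∀ x y : Γ, ∃ (s t : ℝ) (γ : ℝ → Γ), s ≤ t ∧ γ s = x ∧ γ t = y ∧
      ∀ i ∈ Set.Icc s t, ∀ j ∈ Set.Icc s t,
        |i - j| - c ≤ d (γ i) (γ j) ∧ d (γ i) (γ j) ≤ |i - j| + c)
    (hinfinite : Infinite Γ)
    (hnonelem : ¬ ∃ H : Subgroup Γ, H.FiniteIndex ∧ IsCyclic H) :
    ∃ R : ℝ, 0 < R ∧ ∀ x y z : Γ, ∃ w : ℕ → Γ,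
      -- {w_i} is a Gromov sequence: (w_i|w_j)_e → ∞
      Tendsto (fun ij : ℕ × ℕ =>
        (d (w ij.1) 1 + d (w ij.2) 1 - d (w ij.1) (w ij.2)) / 2) atTop atTop ∧
      -- limsup_i (w_i|x)_z ≤ R and limsup_i (w_i|y)_z ≤ R
      ∀ ε : ℝ, 0 < ε → ∀ᶠ i : ℕ in atTop,
        (d (w i) z + d x z - d (w i) x) / 2 ≤ R + ε ∧
        (d (w i) z + d y z - d (w i) y) / 2 ≤ R + ε := by
  obtain ⟨δ, hδ, hhyp⟩ := hhyp
  obtain ⟨c, hc, hqg⟩ := hqg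
  have h : IsHyperbolicGroupMetric d δ (3 * c) :=
    { delta_nonneg := hδ
      error_nonneg := by linarith
      dist_self := fun x => (hzero x x).2 rfl
      symm := hsymm
      tri := htri
      inv := hinv
      proper := hproper
      hyp := fun x y z w => by
        rw [← min_le_iff, min_sub_sub_right]
        exact hhyp x y z w
      interp := fun u v r hr0 hr => by
        obtain ⟨s, t, γ, hst, rfl, rfl, hγ⟩ := hqg u v
        have hs : s ∈ Icc s t := ⟨le_rfl, hst⟩
        have ht : t ∈ Icc s t := ⟨hst, le_rfl⟩
        have hi : s + min r (t - s) ∈ Icc s t :=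
          ⟨by linarith [le_min hr0 (sub_nonneg.2 hst)], by linarith [min_le_right r (t - s)]⟩
        have h1 := hγ s hs t ht
        have h2 := hγ s hs _ hi
        have h3 := hγ _ hi t ht
        rw [abs_of_nonpos (by linarith [hi.1, hi.2])] at h1 h2 h3
        have h4 := min_le_left r (t - s)
        have h5 : r - c ≤ min r (t - s) := le_min (by linarith) (by linarith)
        exact ⟨γ (s + min r (t - s)), abs_le.2 ⟨by linarith, by linarith⟩, by linarith⟩ }
  obtain ⟨p, K, hp, hpK⟩ := h.exists_three_rays (h.exists_isTripod_of_not_virtuallyCyclic hnonelem)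
  have hR : K + δ ≤ |K| + δ + 1 := by linarith [le_abs_self K]
  refine ⟨|K| + δ + 1, by positivity, fun x y z => ?_⟩
  have hpair (x : Γ) (i j : Fin 3) (hij : i ≠ j) :
      (∀ n, gromovProduct d (z * p i n) x z ≤ |K| + δ + 1) ∨
        ∀ n, gromovProduct d (z * p j n) x z ≤ |K| + δ + 1 := by
    by_contra! hcon
    obtain ⟨⟨m, hm⟩, n, hn⟩ := hcon
    have h1 := h.gromovProduct_mul_left z (p i m) (p j n) 1
    rw [mul_one] at h1
    have h2 := hpK i j hij m n
    rcases h.hyp (z * p i m) (z * p j n) x z with h3 | h3 <;> linarith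
  obtain ⟨i, hix, hiy⟩ : ∃ i, (∀ n, gromovProduct d (z * p i n) x z ≤ |K| + δ + 1) ∧
      ∀ n, gromovProduct d (z * p i n) y z ≤ |K| + δ + 1 := by
    by_contra! hcon
    have x01 := hpair x 0 1 (by decide)
    have x02 := hpair x 0 2 (by decide)
    have x12 := hpair x 1 2 (by decide)
    have y01 := hpair y 0 1 (by decide)
    have y02 := hpair y 0 2 (by decide)
    have y12 := hpair y 1 2 (by decide)
    have hno (i : Fin 3) (hx : ∀ n, gromovProduct d (z * p i n) x z ≤ |K| + δ + 1)
        (hy : ∀ n, gromovProduct d (z * p i n) y z ≤ |K| + δ + 1) : False := by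
      obtain ⟨n, hn⟩ := hcon i hx
      exact absurd (hy n) (not_le.2 hn)
    have := hno 0
    have := hno 1
    have := hno 2
    tauto
  refine ⟨fun n => z * p i n, tendsto_atTop.2 fun b => ?_, fun ε hε => .of_forall fun n => ?_⟩
  · obtain ⟨N, hN⟩ := exists_nat_ge (b + d z 1 + 2 * (3 * c) + δ)
    refine eventually_atTop.2 ⟨(N, N), fun ij hij => ?_⟩
    have h1 : (N : ℝ) ≤ min (ij.1 : ℝ) ij.2 :=
      le_min (by exact_mod_cast hij.1) (by exact_mod_cast hij.2)
    have h2 := hp i ij.1 ij.2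
    rw [← h.gromovProduct_mul_left z, mul_one, gromovProduct] at h2
    have t1 := htri (z * p i ij.1) 1 z
    have t2 := htri (z * p i ij.2) 1 z
    rw [hsymm 1 z] at t1 t2
    linarith
  · have h1 := hix n
    have h2 := hiy n
    rw [gromovProduct] at h1 h2
    exact ⟨by linarith, by linarith⟩
end
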